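/- arXiv:1804.05952 — 2 statements merged into one kernel-verified Lean document; each statement's English description precedes it below -/
import Mathlib

section
/- Let m ≥ 3 be an integer and let T be the least positive integer satisfying (T−1)^3 + 17(T−1) ≥ 6(m−3). Then ESO(m,3) ≤ m + T + 1. -/
open Set

/-- A point in the plane. -/
abbrev Pt : Type := ℝ × ℝ

/-- The point set `P` contains an `n`-up-run: `n` points with strictly increasing
`x`-coordinates and nondecreasing `y`-coordinates. -/
def HasUpRun (P : Set Pt) (n : ℕ) : Prop :=
  ∃ f : Fin n → Pt, (∀ i, f i ∈ P) ∧
    StrictMono (fun i => (f i).1) ∧ Monotone (fun i => (f i).2)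

/-- The point set `P` contains an `n`-down-run: `n` points with strictly increasing
`x`-coordinates and strictly decreasing `y`-coordinates. -/
def HasDownRun (P : Set Pt) (n : ℕ) : Prop :=
  ∃ f : Fin n → Pt, (∀ i, f i ∈ P) ∧
    StrictMono (fun i => (f i).1) ∧ StrictAnti (fun i => (f i).2)

/-- A strategy for player A: from the list of previously played points, choose
an x-coordinate. -/
abbrev AStrat : Type := List Pt → ℝ

/-- A strategy for player B: from the list of previously played points and the new
x-coordinate, choose a y-coordinate. -/
abbrev BStrat : Type := List Pt → ℝ → ℝ

/-- Validity of a strategy for player A in either game: the chosen x-coordinate lies in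
`(0,1)` and is distinct from all previously played x-coordinates. -/
def AValid (sA : AStrat) : Prop :=
  ∀ h : List Pt, sA h ∈ Ioo (0:ℝ) 1 ∧ ∀ p ∈ h, sA h ≠ p.1

/-- Validity of a strategy for player B in the game `A_{m,k}`: the chosen y-coordinate
lies in `(0,1)` and is distinct from all previously played y-coordinates. -/
def BValid (sB : BStrat) : Prop :=
  ∀ (h : List Pt) (x : ℝ), sB h x ∈ Ioo (0:ℝ) 1 ∧ ∀ p ∈ h, sB h x ≠ p.2

/-- The list of points played in the first `n` turns when A plays `sA` and B plays `sB`. -/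
def hist (sA : AStrat) (sB : BStrat) : ℕ → List Pt
  | 0 => []
  | n + 1 =>
      let h := hist sA sB n
      h ++ [(sA h, sB h (sA h))]

/-- The set of points played in the first `N` turns. -/
def played (sA : AStrat) (sB : BStrat) (N : ℕ) : Set Pt :=
  {p | p ∈ hist sA sB N}

/-- In the game `A_{m,k}`, strategy `sA` of player A is valid and guarantees an
`m`-up-run or a `k`-down-run among the first `N` points, against every valid
strategy of player B. -/
def AWinsBy (m k N : ℕ) (sA : AStrat) : Prop :=
  AValid sA ∧ ∀ sB : BStrat, BValid sB →
    HasUpRun (played sA sB N) m ∨ HasDownRun (played sA sB N) k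

/-- The Erdős–Szekeres on-line number `ESO(m,k)`: the least `N` such that player A
has a strategy forcing an `m`-up-run or a `k`-down-run within `N` turns. -/
noncomputable def ESO (m k : ℕ) : ℕ := sInf {N | ∃ sA : AStrat, AWinsBy m k N sA}

/-- Validity of a strategy for player B in the tier game `B_{m,k}`: the chosen
y-coordinate is an integer in `{1, …, k-1}` (repetitions allowed). -/
def BTierValid (k : ℕ) (sB : BStrat) : Prop :=
  ∀ (h : List Pt) (x : ℝ), ∃ j : ℕ, 1 ≤ j ∧ j ≤ k - 1 ∧ sB h x = (j : ℝ)

/-- In the tier game `B_{m,k}`, strategy `sA` of player A is valid and guarantees an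
`m`-up-run among the first `N` points, against every valid strategy of player B. -/
def AWinsTierBy (m k N : ℕ) (sA : AStrat) : Prop :=
  AValid sA ∧ ∀ sB : BStrat, BTierValid k sB → HasUpRun (played sA sB N) m

/-- `B(m,k)`: the least `N` such that player A has a strategy forcing an `m`-up-run
within `N` turns of the tier game `B_{m,k}`. -/
noncomputable def BNum (m k : ℕ) : ℕ := sInf {N | ∃ sA : AStrat, AWinsTierBy m k N sA}

/-! ### Strict dominance, descents and the point reflection -/

/-- Strict dominance in both coordinates. -/
def Prec (p q : Pt) : Prop := p.1 < q.1 ∧ p.2 < q.2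

/-- `P` contains three points forming a down-run. -/
def HasDescent (P : Set Pt) : Prop :=
  ∃ a ∈ P, ∃ b ∈ P, ∃ c ∈ P, a.1 < b.1 ∧ b.1 < c.1 ∧ b.2 < a.2 ∧ c.2 < b.2

/-- The point `z` has a new height and completes no descent with `P`. -/
def Admissible (P : Set Pt) (z : Pt) : Prop :=
  (∀ p ∈ P, z.2 ≠ p.2) ∧ ¬ HasDescent (insert z P)

/-- The reflection of the unit square at its centre. -/
def reflect (p : Pt) : Pt := (1 - p.1, 1 - p.2)

@[simp] lemma reflect_fst (p : Pt) : (reflect p).1 = 1 - p.1 := rfl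

@[simp] lemma reflect_snd (p : Pt) : (reflect p).2 = 1 - p.2 := rfl

@[simp] lemma reflect_reflect (p : Pt) : reflect (reflect p) = p := by
  ext <;> simp

lemma preimage_reflect_insert (z : Pt) (P : Set Pt) :
    reflect ⁻¹' insert z P = insert (reflect z) (reflect ⁻¹' P) := by
  ext p
  simp only [mem_preimage, mem_insert_iff]
  constructor
  · rintro (h | h)
    · left; rw [← h, reflect_reflect]
    · exact Or.inr h
  · rintro (h | h)
    · left; rw [h, reflect_reflect]
    · exact Or.inr h

@[simp] lemma preimage_reflect_reflect (P : Set Pt) : reflect ⁻¹' (reflect ⁻¹' P) = P := by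
  ext p; simp

lemma prec_reflect {p q : Pt} : Prec (reflect p) (reflect q) ↔ Prec q p := by
  simp [Prec]

lemma HasDescent.reflect {P : Set Pt} (h : HasDescent P) : HasDescent (reflect ⁻¹' P) := by
  obtain ⟨a, ha, b, hb, c, hc, h1, h2, h3, h4⟩ := h
  refine ⟨_root_.reflect c, by simpa, _root_.reflect b, by simpa, _root_.reflect a, by simpa, ?_⟩
  simp [*]

lemma Admissible.reflect {P : Set Pt} {z : Pt} (h : Admissible P z) :
    Admissible (reflect ⁻¹' P) (reflect z) := by
  refine ⟨fun p hp hz => h.1 _ hp ?_, fun hd => h.2 ?_⟩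
  · simp only [reflect_snd] at hz ⊢; linarith
  · rw [← preimage_reflect_insert] at hd
    simpa using hd.reflect

lemma Admissible.of_insert {P : Set Pt} {q z : Pt} (h : Admissible (insert q P) z) :
    Admissible P z := by
  refine ⟨fun p hp => h.1 p (mem_insert_of_mem _ hp), ?_⟩
  rintro ⟨a, ha, b, hb, c, hc, h'⟩
  have hs : insert z P ⊆ insert z (insert q P) := insert_subset_insert (subset_insert _ _)
  exact h.2 ⟨a, hs ha, b, hs hb, c, hs hc, h'⟩

/-- An admissible point to the right of an inversion lies above its lower point. -/
lemma Admissible.lt_of_inversion_left {P : Set Pt} {u v z : Pt} (h : Admissible P z)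
    (hu : u ∈ P) (hv : v ∈ P) (h1 : u.1 < v.1) (h2 : v.2 < u.2) (hz : v.1 < z.1) :
    v.2 < z.2 := by
  by_contra! hle
  exact h.2 ⟨u, Or.inr hu, v, Or.inr hv, z, Or.inl rfl, h1, hz, h2,
    lt_of_le_of_ne hle (h.1 v hv)⟩

/-- An admissible point to the left of an inversion lies below its upper point. -/
lemma Admissible.lt_of_inversion_right {P : Set Pt} {u v z : Pt} (h : Admissible P z)
    (hu : u ∈ P) (hv : v ∈ P) (h1 : u.1 < v.1) (h2 : v.2 < u.2) (hz : z.1 < u.1) :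
    z.2 < u.2 := by
  by_contra! hle
  exact h.2 ⟨z, Or.inl rfl, u, Or.inr hu, v, Or.inr hv, hz, h1,
    lt_of_le_of_ne hle (h.1 u hu).symm, h2⟩

/-! ### Positions of the game -/

/-- A position whose up-run `L ++ C ++ R` is protected outside of `C`: admissible points to
the right of `L` lie above `L`, and admissible points to the left of `R` lie below `R`. -/
structure IsFree (P : Set Pt) (ξ ζ : ℝ) (L C R : List Pt) : Prop where
  lt : ξ < ζ
  nonneg : 0 ≤ ξ
  le_one : ζ ≤ 1
  chain : (L ++ C ++ R).Pairwise Prec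
  mem : ∀ p ∈ L ++ C ++ R, p ∈ P
  left : ∀ p ∈ L, p.1 ≤ ξ
  right : ∀ p ∈ R, ζ ≤ p.1
  inside : ∀ p ∈ C, ξ < p.1 ∧ p.1 < ζ
  guardL : ∀ z, Admissible P z → (∀ v ∈ L, v.1 < z.1) → ∀ v ∈ L, v.2 < z.2
  guardR : ∀ z, Admissible P z → (∀ v ∈ R, z.1 < v.1) → ∀ v ∈ R, z.2 < v.2

/-- A position whose up-run `L ++ A ++ B ++ R` is protected outside of `A` and `B`, together
with an inversion `(a, b)` around the gap between `ξ` and `ζ`. -/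
structure IsLocked (P : Set Pt) (ξ ζ : ℝ) (L A B R : List Pt) (a b : Pt) : Prop where
  lt : ξ < ζ
  nonneg : 0 ≤ ξ
  le_one : ζ ≤ 1
  chain : (L ++ A ++ (B ++ R)).Pairwise Prec
  mem : ∀ p ∈ L ++ A ++ (B ++ R), p ∈ P
  left : ∀ p ∈ L ++ A, p.1 ≤ ξ
  right : ∀ p ∈ B ++ R, ζ ≤ p.1
  mem_a : a ∈ P
  mem_b : b ∈ P
  a_le : a.1 ≤ ξ
  le_b : ζ ≤ b.1
  inv : b.2 < a.2
  below_b : ∀ p ∈ L ++ A, p.2 < b.2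
  above_a : ∀ p ∈ B ++ R, a.2 < p.2
  left_a : ∀ p ∈ A, p.1 < a.1
  right_b : ∀ p ∈ B, b.1 < p.1
  nonneg_A : ∀ p ∈ A, 0 ≤ p.1
  le_one_B : ∀ p ∈ B, p.1 ≤ 1
  guardL : ∀ z, Admissible P z → (∀ v ∈ L, v.1 < z.1) → ∀ v ∈ L, v.2 < z.2
  guardR : ∀ z, Admissible P z → (∀ v ∈ R, z.1 < v.1) → ∀ v ∈ R, z.2 < v.2

/-- Some up-run with `r` points has all but `n` consecutive points protected. -/
def FreeState (P : Set Pt) (r n : ℕ) : Prop :=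
  ∃ ξ ζ L C R, IsFree P ξ ζ L C R ∧ (L ++ C ++ R).length = r ∧ C.length = n

/-- Some up-run with `r` points has all but `l + k` points protected, `l` of them before and
`k` of them after a gap surrounded by an inversion. -/
def LockedState (P : Set Pt) (r l k : ℕ) : Prop :=
  ∃ ξ ζ L A B R a b, IsLocked P ξ ζ L A B R a b ∧
    (L ++ A ++ (B ++ R)).length = r ∧ A.length = l ∧ B.length = k

lemma pairwise_reverse_map_reflect {l : List Pt} :
    (l.map reflect).reverse.Pairwise Prec ↔ l.Pairwise Prec := by
  rw [List.pairwise_reverse, List.pairwise_map]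
  simp only [prec_reflect]

lemma forall_mem_reverse_map {l : List Pt} {p : Pt → Prop} :
    (∀ x ∈ (l.map reflect).reverse, p x) ↔ ∀ x ∈ l, p (reflect x) := by
  simp only [List.mem_reverse, List.forall_mem_map]

lemma IsFree.reflect {P : Set Pt} {ξ ζ : ℝ} {L C R : List Pt} (h : IsFree P ξ ζ L C R) :
    IsFree (reflect ⁻¹' P) (1 - ζ) (1 - ξ) (R.map reflect).reverse (C.map reflect).reverse
      (L.map reflect).reverse := by
  have e : (R.map _root_.reflect).reverse ++ (C.map _root_.reflect).reverse ++
      (L.map _root_.reflect).reverse = ((L ++ C ++ R).map _root_.reflect).reverse := by simp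
  refine ⟨by linarith [h.lt], by linarith [h.le_one], by linarith [h.nonneg], ?_, ?_, ?_, ?_, ?_,
    fun z hz hx => ?_, fun z hz hx => ?_⟩
  · rw [e, pairwise_reverse_map_reflect]; exact h.chain
  · rw [e, forall_mem_reverse_map]; simpa using h.mem
  · rw [forall_mem_reverse_map]; intro p hp; exact sub_le_sub_left (h.right p hp) 1
  · rw [forall_mem_reverse_map]; intro p hp; exact sub_le_sub_left (h.left p hp) 1
  · rw [forall_mem_reverse_map]; simpa [and_comm] using h.inside
  · rw [forall_mem_reverse_map] at hx ⊢; intro v hv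
    have := h.guardR (_root_.reflect z) (by simpa using hz.reflect)
      (fun v hv => by have := hx v hv; simp only [reflect_fst] at this ⊢; linarith) v hv
    simp only [reflect_snd] at this ⊢; linarith
  · rw [forall_mem_reverse_map] at hx ⊢; intro v hv
    have := h.guardL (_root_.reflect z) (by simpa using hz.reflect)
      (fun v hv => by have := hx v hv; simp only [reflect_fst] at this ⊢; linarith) v hv
    simp only [reflect_snd] at this ⊢; linarith

lemma IsLocked.reflect {P : Set Pt} {ξ ζ : ℝ} {L A B R : List Pt} {a b : Pt}
    (h : IsLocked P ξ ζ L A B R a b) :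
    IsLocked (reflect ⁻¹' P) (1 - ζ) (1 - ξ) (R.map reflect).reverse (B.map reflect).reverse
      (A.map reflect).reverse (L.map reflect).reverse (reflect b) (reflect a) := by
  have e₁ : (R.map _root_.reflect).reverse ++ (B.map _root_.reflect).reverse =
      ((B ++ R).map _root_.reflect).reverse := by simp
  have e₂ : (A.map _root_.reflect).reverse ++ (L.map _root_.reflect).reverse =
      ((L ++ A).map _root_.reflect).reverse := by simp
  have e : ((B ++ R).map _root_.reflect).reverse ++ ((L ++ A).map _root_.reflect).reverse =
      ((L ++ A ++ (B ++ R)).map _root_.reflect).reverse := by simp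
  constructor
  case lt => linarith [h.lt]
  case nonneg => linarith [h.le_one]
  case le_one => linarith [h.nonneg]
  case chain => rw [e₁, e₂, e, pairwise_reverse_map_reflect]; exact h.chain
  case mem =>
    rw [e₁, e₂, e, forall_mem_reverse_map]; intro p hp; simpa using h.mem p hp
  case left =>
    rw [e₁, forall_mem_reverse_map]; intro p hp; exact sub_le_sub_left (h.right p hp) 1
  case right =>
    rw [e₂, forall_mem_reverse_map]; intro p hp; exact sub_le_sub_left (h.left p hp) 1
  case mem_a => simpa using h.mem_b
  case mem_b => simpa using h.mem_a
  case a_le => exact sub_le_sub_left h.le_b 1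
  case le_b => exact sub_le_sub_left h.a_le 1
  case inv => simpa using h.inv
  case below_b =>
    rw [e₁, forall_mem_reverse_map]; intro p hp; simpa using h.above_a p hp
  case above_a =>
    rw [e₂, forall_mem_reverse_map]; intro p hp; simpa using h.below_b p hp
  case left_a => rw [forall_mem_reverse_map]; simpa using h.right_b
  case right_b => rw [forall_mem_reverse_map]; simpa using h.left_a
  case nonneg_A => rw [forall_mem_reverse_map]; simpa using h.le_one_B
  case le_one_B => rw [forall_mem_reverse_map]; simpa using h.nonneg_A
  case guardL =>
    intro z hz hx
    rw [forall_mem_reverse_map] at hx ⊢; intro v hv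
    have := h.guardR (_root_.reflect z) (by simpa using hz.reflect)
      (fun v hv => by have := hx v hv; simp only [reflect_fst] at this ⊢; linarith) v hv
    simp only [reflect_snd] at this ⊢; linarith
  case guardR =>
    intro z hz hx
    rw [forall_mem_reverse_map] at hx ⊢; intro v hv
    have := h.guardL (_root_.reflect z) (by simpa using hz.reflect)
      (fun v hv => by have := hx v hv; simp only [reflect_fst] at this ⊢; linarith) v hv
    simp only [reflect_snd] at this ⊢; linarith

lemma FreeState.reflect {P : Set Pt} {r n : ℕ} (h : FreeState P r n) :
    FreeState (reflect ⁻¹' P) r n := by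
  obtain ⟨ξ, ζ, L, C, R, h, hr, hn⟩ := h
  refine ⟨_, _, _, _, _, h.reflect, ?_, by simpa using hn⟩
  simp only [List.length_append, List.length_reverse, List.length_map] at hr ⊢; omega

lemma LockedState.reflect {P : Set Pt} {r l k : ℕ} (h : LockedState P r l k) :
    LockedState (reflect ⁻¹' P) r k l := by
  obtain ⟨ξ, ζ, L, A, B, R, a, b, h, hr, hl, hk⟩ := h
  refine ⟨_, _, _, _, _, _, _, _, h.reflect, ?_, by simpa using hk, by simpa using hl⟩
  simp only [List.length_append, List.length_reverse, List.length_map] at hr ⊢; omega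

/-! ### The effect of one move -/

/-- A chain splits at every height that it avoids. -/
lemma exists_split_height {C : List Pt} (hC : C.Pairwise Prec) {y : ℝ}
    (hy : ∀ p ∈ C, y ≠ p.2) :
    ∃ D E, C = D ++ E ∧ (∀ p ∈ D, p.2 < y) ∧ ∀ p ∈ E, y < p.2 := by
  induction C with
  | nil => exact ⟨[], [], by simp⟩
  | cons c C ih =>
    rw [List.pairwise_cons] at hC
    rcases lt_or_gt_of_ne (hy c (by simp)) with h | h
    · refine ⟨[], c :: C, rfl, by simp, ?_⟩
      intro p hp
      rcases List.mem_cons.1 hp with rfl | hp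
      · exact h
      · exact h.trans (hC.1 p hp).2
    · obtain ⟨D, E, rfl, hD, hE⟩ := ih hC.2 fun p hp => hy p (by simp [hp])
      exact ⟨c :: D, E, rfl, by simpa [h] using hD, hE⟩

/-- Two separated lists of points can be separated by an abscissa. -/
lemma exists_gap {S : List Pt} {t : ℝ} (h : ∀ p ∈ S, p.1 < t) :
    ∃ x < t, ∀ p ∈ S, p.1 < x := by
  induction S with
  | nil => exact ⟨t - 1, by linarith, by simp⟩
  | cons c S ih =>
    obtain ⟨x, hx, hS⟩ := ih fun p hp => h p (by simp [hp])
    obtain ⟨y, hy, hyt⟩ := exists_between (max_lt hx (h c (by simp)))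
    refine ⟨y, hyt, ?_⟩
    intro p hp
    rcases List.mem_cons.1 hp with rfl | hp
    · exact (le_max_right _ _).trans_lt hy
    · exact (hS p hp).trans ((le_max_left _ _).trans_lt hy)

/-- An answer above the inversion of a locked position can be met without moving the gap. -/
lemma IsLocked.stay_above {P : Set Pt} {ξ ζ : ℝ} {L A D E R : List Pt} {a b z : Pt}
    (h : IsLocked P ξ ζ L A (D ++ E) R a b) (hz : Admissible P z) (h1 : ξ < z.1) (h2 : z.1 < ζ)
    (haz : a.2 < z.2) (hE : ∀ p ∈ E, z.2 < p.2) :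
    IsLocked (insert z P) ξ z.1 L A [] (z :: (E ++ R)) a b := by
  have hR : ∀ p ∈ R, z.1 < p.1 := fun p hp => h2.trans_le (h.right p (by simp [hp]))
  have hR' := h.guardR z hz hR
  have hzE : ∀ p ∈ E, z.1 < p.1 := fun p hp => h2.trans_le (h.right p (by simp [hp]))
  have hLA : ∀ p ∈ L ++ A, Prec p z := fun p hp =>
    ⟨(h.left p hp).trans_lt h1, (h.below_b p hp).trans (h.inv.trans haz)⟩
  have hzER : ∀ p ∈ E ++ R, Prec z p := by
    intro p hp
    rcases List.mem_append.1 hp with hp | hp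
    · exact ⟨hzE p hp, hE p hp⟩
    · exact ⟨hR p hp, hR' p hp⟩
  constructor
  case lt => exact h1
  case nonneg => exact h.nonneg
  case le_one => exact h2.le.trans h.le_one
  case chain =>
    have hc := h.chain
    rw [List.append_assoc D, List.pairwise_append, ] at hc
    rw [List.nil_append, List.pairwise_append, List.pairwise_cons]
    refine ⟨hc.1, ⟨hzER, (List.pairwise_append.1 hc.2.1).2.1⟩, ?_⟩
    intro p hp q hq
    rcases List.mem_cons.1 hq with rfl | hq
    · exact hLA p hp
    · exact hc.2.2 p hp q (by simp only [List.mem_append] at hq ⊢; tauto)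
  case mem =>
    intro p hp
    simp only [List.nil_append, List.mem_append, List.mem_cons] at hp
    by_cases hpz : p = z
    · exact Or.inl hpz
    · exact Or.inr (h.mem p (by simp only [List.mem_append]; tauto))
  case left => exact h.left
  case right =>
    intro p hp
    rcases List.mem_cons.1 hp with rfl | hp
    · exact le_rfl
    · exact (hzER p hp).1.le
  case mem_a => exact Or.inr h.mem_a
  case mem_b => exact Or.inr h.mem_b
  case a_le => exact h.a_le
  case le_b => exact h2.le.trans h.le_b
  case inv => exact h.inv
  case below_b => exact h.below_b
  case above_a =>
    intro p hp
    rcases List.mem_cons.1 hp with rfl | hp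
    · exact haz
    · exact haz.trans (hzER p hp).2
  case left_a => exact h.left_a
  case right_b => simp
  case nonneg_A => exact h.nonneg_A
  case le_one_B => simp
  case guardL => exact fun w hw => h.guardL w hw.of_insert
  case guardR =>
    intro w hw hwR v hv
    have : w.2 < z.2 := hw.lt_of_inversion_right (Or.inl rfl) (Or.inr h.mem_b)
      (h2.trans_le h.le_b) (h.inv.trans haz) (hwR z (by simp))
    rcases List.mem_cons.1 hv with rfl | hv
    · exact this
    · exact this.trans (hzER v hv).2

/-- An answer above the inversion of a locked position can be met by moving the gap. -/
lemma IsLocked.move_above {P : Set Pt} {ξ ζ : ℝ} {L A D E R : List Pt} {a b d z : Pt}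
    (h : IsLocked P ξ ζ L A (D ++ d :: E) R a b) (hz : Admissible P z) (h1 : ξ < z.1)
    (h2 : z.1 < ζ) (haz : a.2 < z.2) (hD : ∀ p ∈ D, p.2 < z.2) (hd : d.2 < z.2)
    (hE : ∀ p ∈ E, z.2 < p.2) :
    ∃ x, IsLocked (insert z P) x d.1 (L ++ A ++ b :: D) [] E R z d := by
  have hR : ∀ p ∈ R, z.1 < p.1 := fun p hp => h2.trans_le (h.right p (by simp [hp]))
  have hR' := h.guardR z hz hR
  obtain ⟨cLA, cB, cLAB⟩ := List.pairwise_append.1 h.chain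
  rw [List.append_assoc, List.cons_append, List.pairwise_append, List.pairwise_cons] at cB
  obtain ⟨cD, ⟨cdE, cE⟩, cDE⟩ := cB
  have hLAb : ∀ p ∈ L ++ A, Prec p b := fun p hp =>
    ⟨((h.left p hp).trans_lt h.lt).trans_le h.le_b, h.below_b p hp⟩
  have hbB : ∀ p ∈ D ++ d :: E, Prec b p := fun p hp =>
    ⟨h.right_b p hp, h.inv.trans (h.above_a p (List.mem_append_left _ hp))⟩
  have hLd : ∀ p ∈ L ++ A ++ b :: D, Prec p d := by
    intro p hp
    rcases List.mem_append.1 hp with hp | hp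
    · exact cLAB p hp d (by simp)
    rcases List.mem_cons.1 hp with rfl | hp
    · exact hbB d (by simp)
    · exact cDE p hp d (by simp)
  obtain ⟨x, hxd, hx⟩ := exists_gap fun p hp => (hLd p hp).1
  have hbx : b.1 < x := hx b (by simp)
  have hzb : z.1 < b.1 := h2.trans_le h.le_b
  refine ⟨x, ?_⟩
  constructor
  case lt => exact hxd
  case nonneg => linarith [h.nonneg]
  case le_one => exact h.le_one_B d (by simp)
  case chain =>
    rw [List.append_nil, List.pairwise_append, List.pairwise_append, List.pairwise_cons]
    refine ⟨⟨cLA, ⟨fun p hp => hbB p (by simp [hp]), cD⟩, ?_⟩, cE, ?_⟩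
    · intro p hp q hq
      rcases List.mem_cons.1 hq with rfl | hq
      · exact hLAb p hp
      · exact cLAB p hp q (by simp [hq])
    · intro p hp q hq
      have hpd := hLd p hp
      have hdq := cdE q hq
      exact ⟨hpd.1.trans hdq.1, hpd.2.trans hdq.2⟩
  case mem =>
    intro p hp
    by_cases hpz : p = b
    · exact hpz ▸ Or.inr h.mem_b
    · refine Or.inr (h.mem p ?_)
      simp only [List.append_nil, List.mem_append, List.mem_cons] at hp ⊢
      tauto
  case left => exact fun p hp => (hx p (by simpa using hp)).le
  case right => exact fun p hp => (cdE p hp).1.le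
  case mem_a => exact Or.inl rfl
  case mem_b => exact Or.inr (h.mem d (by simp))
  case a_le => linarith
  case le_b => exact le_rfl
  case inv => exact hd
  case below_b => exact fun p hp => (hLd p (by simpa using hp)).2
  case above_a =>
    intro p hp
    rcases List.mem_append.1 hp with hp | hp
    · exact hE p hp
    · exact hR' p hp
  case left_a => simp
  case right_b => exact fun p hp => (cdE p (by simp [hp])).1
  case nonneg_A => simp
  case le_one_B => exact fun p hp => h.le_one_B p (by simp [hp])
  case guardL =>
    intro w hw hwL v hv
    have hb : b.2 < w.2 := hw.lt_of_inversion_left (Or.inl rfl) (Or.inr h.mem_b)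
      hzb (h.inv.trans haz) (hwL b (by simp))
    rcases List.mem_append.1 hv with hv | hv
    · exact (h.below_b v hv).trans hb
    rcases List.mem_cons.1 hv with rfl | hv'
    · exact hb
    · exact hw.lt_of_inversion_left (Or.inl rfl) (Or.inr (h.mem v (by simp [hv'])))
        (hzb.trans (hbB v (by simp [hv'])).1) (hD v hv') (hwL v (by simp [hv']))
  case guardR => exact fun w hw => h.guardR w hw.of_insert

/-- Playing between a point and a later point of the protected up-run, with an answer that
fits, extends the up-run. -/
lemma IsFree.extend {P : Set Pt} {ξ ζ : ℝ} {L C D R : List Pt} {z : Pt}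
    (h : IsFree P ξ ζ L (C ++ D) R) (hz : Admissible P z) (h1 : ξ < z.1) (h2 : z.1 < ζ)
    (hC : ∀ p ∈ C, Prec p z) (hD : ∀ p ∈ D, Prec z p) :
    IsFree (insert z P) ξ ζ L (C ++ z :: D) R := by
  have hL : ∀ p ∈ L, p.1 < z.1 := fun p hp => (h.left p hp).trans_lt h1
  have hR : ∀ p ∈ R, z.1 < p.1 := fun p hp => h2.trans_le (h.right p hp)
  have hL' := h.guardL z hz hL
  have hR' := h.guardR z hz hR
  have e : L ++ (C ++ D) ++ R = (L ++ C) ++ (D ++ R) := by simp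
  have e' : L ++ (C ++ z :: D) ++ R = (L ++ C) ++ z :: (D ++ R) := by simp
  constructor
  case lt => exact h.lt
  case nonneg => exact h.nonneg
  case le_one => exact h.le_one
  case chain =>
    have hc := h.chain
    rw [e, List.pairwise_append] at hc
    rw [e', List.pairwise_append, List.pairwise_cons]
    refine ⟨hc.1, ⟨?_, hc.2.1⟩, ?_⟩
    · intro q hq
      rcases List.mem_append.1 hq with hq | hq
      · exact hD q hq
      · exact ⟨hR q hq, hR' q hq⟩
    · intro p hp q hq
      rcases List.mem_cons.1 hq with rfl | hq
      · rcases List.mem_append.1 hp with hp | hp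
        · exact ⟨hL p hp, hL' p hp⟩
        · exact hC p hp
      · exact hc.2.2 p hp q hq
  case mem =>
    intro p hp
    by_cases hpz : p = z
    · exact Or.inl hpz
    · exact Or.inr (h.mem p (by simp only [List.mem_append, List.mem_cons] at hp ⊢; tauto))
  case left => exact h.left
  case right => exact h.right
  case inside =>
    intro p hp
    by_cases hpz : p = z
    · exact hpz ▸ ⟨h1, h2⟩
    · exact h.inside p (by simp only [List.mem_append, List.mem_cons] at hp ⊢; tauto)
  case guardL => exact fun w hw => h.guardL w hw.of_insert
  case guardR => exact fun w hw => h.guardR w hw.of_insert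

/-- After an answer above the point `d` to its right, everything up to `d` is
protected. -/
lemma IsFree.advance_above {P : Set Pt} {ξ ζ : ℝ} {L C D E R : List Pt} {d z : Pt}
    (h : IsFree P ξ ζ L (C ++ (D ++ d :: E)) R) (hzd : z.1 < d.1) (hd : d.2 < z.2) :
    IsFree (insert z P) d.1 ζ (L ++ C ++ D ++ [d]) E R := by
  have e : L ++ (C ++ (D ++ d :: E)) ++ R = L ++ C ++ D ++ d :: (E ++ R) := by simp
  have e' : L ++ C ++ D ++ [d] ++ E ++ R = L ++ C ++ D ++ d :: (E ++ R) := by simp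
  have hd' := h.inside d (by simp)
  have hc := h.chain
  rw [e, List.pairwise_append, List.pairwise_cons] at hc
  have hle : ∀ p ∈ L ++ C ++ D ++ [d], p.1 ≤ d.1 ∧ p.2 ≤ d.2 := by
    intro p hp
    rcases List.mem_append.1 hp with hp | hp
    · have := hc.2.2 p hp d (by simp)
      exact ⟨this.1.le, this.2.le⟩
    · rw [List.mem_singleton.1 hp]
      exact ⟨le_rfl, le_rfl⟩
  constructor
  case lt => exact hd'.2
  case nonneg => exact h.nonneg.trans hd'.1.le
  case le_one => exact h.le_one
  case chain => rw [e', ← e]; exact h.chain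
  case mem => rw [e', ← e]; exact fun p hp => Or.inr (h.mem p hp)
  case left => exact fun p hp => (hle p hp).1
  case right => exact h.right
  case inside =>
    exact fun p hp => ⟨(hc.2.1.1 p (by simp [hp])).1, (h.inside p (by simp [hp])).2⟩
  case guardL =>
    intro w hw hwL v hv
    exact (hle v hv).2.trans_lt (hw.lt_of_inversion_left (Or.inl rfl)
      (Or.inr (h.mem d (by simp))) hzd hd (hwL d (by simp)))
  case guardR => exact fun w hw => h.guardR w hw.of_insert

lemma IsFree.lock_above_aux {P : Set Pt} {ξ ζ x : ℝ} {L C D E R L' A : List Pt} {d z : Pt}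
    (h : IsFree P ξ ζ L (C ++ (D ++ d :: E)) R) (hz : Admissible P z) (h1 : ξ < z.1)
    (hzd : z.1 < d.1) (hd : d.2 < z.2) (hE : ∀ p ∈ E, z.2 < p.2)
    (hLA : L' ++ A = L ++ C ++ D) (hzx : z.1 ≤ x) (hxd : x < d.1) (hx : ∀ p ∈ L' ++ A, p.1 ≤ x)
    (hA : ∀ p ∈ A, p.1 < z.1 ∧ 0 ≤ p.1)
    (guardL : ∀ w, Admissible (insert z P) w → (∀ v ∈ L', v.1 < w.1) → ∀ v ∈ L', v.2 < w.2) :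
    IsLocked (insert z P) x d.1 L' A E R z d := by
  have e : L ++ (C ++ (D ++ d :: E)) ++ R = L ++ C ++ D ++ d :: (E ++ R) := by simp
  have hd' := h.inside d (by simp)
  have hc := h.chain
  rw [e, ← hLA, List.pairwise_append, List.pairwise_cons] at hc
  have hR' := h.guardR z hz fun p hp =>
    (hzd.trans hd'.2).trans_le (h.right p hp)
  constructor
  case lt => exact hxd
  case nonneg => exact (h.nonneg.trans h1.le).trans hzx
  case le_one => exact hd'.2.le.trans h.le_one
  case chain =>
    rw [List.pairwise_append]
    exact ⟨hc.1, hc.2.1.2, fun p hp q hq => hc.2.2 p hp q (by simp [hq])⟩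
  case mem =>
    rw [hLA]
    exact fun p hp => Or.inr (h.mem p (by
      simp only [List.mem_append, List.mem_cons] at hp ⊢; tauto))
  case left => exact hx
  case right => exact fun p hp => (hc.2.1.1 p hp).1.le
  case mem_a => exact Or.inl rfl
  case mem_b => exact Or.inr (h.mem d (by simp))
  case a_le => exact hzx
  case le_b => exact le_rfl
  case inv => exact hd
  case below_b => exact fun p hp => (hc.2.2 p hp d (by simp)).2
  case above_a =>
    intro p hp
    rcases List.mem_append.1 hp with hp | hp
    · exact hE p hp
    · exact hR' p hp
  case left_a => exact fun p hp => (hA p hp).1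
  case right_b => exact fun p hp => (hc.2.1.1 p (by simp [hp])).1
  case nonneg_A => exact fun p hp => (hA p hp).2
  case le_one_B => exact fun p hp => (h.inside p (by simp [hp])).2.le.trans h.le_one
  case guardL => exact guardL
  case guardR => exact fun w hw => h.guardR w hw.of_insert

/-- After an answer above the points `D ++ [d]` to its right, one can give up `d` to enter a
locked position. -/
lemma IsFree.lock_above {P : Set Pt} {ξ ζ : ℝ} {L C D E R : List Pt} {d z : Pt}
    (h : IsFree P ξ ζ L (C ++ (D ++ d :: E)) R) (hz : Admissible P z) (h1 : ξ < z.1)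
    (hC : ∀ p ∈ C, p.1 < z.1) (hD : ∀ p ∈ D ++ d :: E, z.1 < p.1)
    (hDz : ∀ p ∈ D, p.2 < z.2) (hd : d.2 < z.2) (hE : ∀ p ∈ E, z.2 < p.2) :
    ∃ x L' A, IsLocked (insert z P) x d.1 L' A E R z d ∧ L' ++ A = L ++ C ++ D ∧
      A.length ≤ C.length := by
  have hzd := hD d (by simp)
  rcases List.eq_nil_or_concat' D with rfl | ⟨D, c, rfl⟩
  · refine ⟨z.1, L, C, h.lock_above_aux hz h1 hzd hd hE (by simp) le_rfl hzd ?_ ?_ ?_,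
      by simp, le_rfl⟩
    · intro p hp
      rcases List.mem_append.1 hp with hp | hp
      · exact (h.left p hp).trans h1.le
      · exact (hC p hp).le
    · exact fun p hp => ⟨hC p hp, h.nonneg.trans (h.inside p (by simp [hp])).1.le⟩
    · exact fun w hw => h.guardL w hw.of_insert
  · have hzc := hD c (by simp)
    have e : L ++ (C ++ ((D ++ [c]) ++ d :: E)) ++ R = (L ++ C ++ D) ++ c :: (d :: (E ++ R)) := by
      simp
    have hc := h.chain
    rw [e, List.pairwise_append, List.pairwise_cons] at hc
    have hcd := hc.2.1.1 d (by simp)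
    have hle : ∀ p ∈ L ++ C ++ (D ++ [c]), p.1 ≤ c.1 ∧ p.2 ≤ c.2 := by
      intro p hp
      rw [← List.append_assoc] at hp
      rcases List.mem_append.1 hp with hp | hp
      · have := hc.2.2 p hp c (by simp)
        exact ⟨this.1.le, this.2.le⟩
      · rw [List.mem_singleton.1 hp]
        exact ⟨le_rfl, le_rfl⟩
    refine ⟨c.1, L ++ C ++ (D ++ [c]), [], h.lock_above_aux hz h1 hzd hd hE (by simp) hzc.le
      hcd.1 ?_ (by simp) ?_, by simp, by simp⟩
    · exact fun p hp => (hle p (by simpa using hp)).1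
    · intro w hw hwL v hv
      exact (hle v hv).2.trans_lt (hw.lt_of_inversion_left (Or.inl rfl)
        (Or.inr (h.mem c (by simp))) hzc (hDz c (by simp)) (hwL c (by simp)))

lemma IsFree.answer_above {P : Set Pt} {ξ ζ : ℝ} {L C D R : List Pt} {z : Pt}
    (h : IsFree P ξ ζ L (C ++ D) R) (hz : Admissible P z) (h1 : ξ < z.1)
    (hC : ∀ p ∈ C, p.1 < z.1) (hD : ∀ p ∈ D, z.1 < p.1) (hDz : ∃ p ∈ D, p.2 < z.2) :
    ∃ k < D.length, FreeState (insert z P) (L ++ (C ++ D) ++ R).length k ∧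
      ∃ l ≤ C.length, LockedState (insert z P) ((L ++ (C ++ D) ++ R).length - 1) l k := by
  obtain ⟨D, E, rfl, hDz', hE⟩ := exists_split_height (C := D) (y := z.2)
    (by have hc := h.chain; simp only [List.pairwise_append] at hc; exact hc.1.2.1.2.1)
    fun p hp => hz.1 p (h.mem p (by simp only [List.mem_append]; tauto))
  rcases List.eq_nil_or_concat' D with rfl | ⟨D, d, rfl⟩
  · obtain ⟨p, hp, hpz⟩ := hDz
    exact absurd (hE p (by simpa using hp)) hpz.le.not_gt
  rw [List.append_assoc, List.singleton_append] at h hD ⊢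
  have hd := hDz' d (by simp)
  obtain ⟨x, L', A, hl, hLA, hA⟩ := h.lock_above hz h1 hC hD
    (fun p hp => hDz' p (by simp [hp])) hd hE
  refine ⟨E.length, by simp; omega, ⟨_, _, _, _, _,
    h.advance_above (hD d (by simp)) hd, by simp, rfl⟩, A.length, hA,
    _, _, _, _, _, _, _, _, hl, ?_, rfl, rfl⟩
  rw [hLA]
  simp; omega

/-- The three kinds of answers in a free position. -/
lemma IsFree.answer {P : Set Pt} {ξ ζ : ℝ} {L C D R : List Pt} {z : Pt}
    (h : IsFree P ξ ζ L (C ++ D) R) (hz : Admissible P z) (h1 : ξ < z.1) (h2 : z.1 < ζ)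
    (hC : ∀ p ∈ C, p.1 < z.1) (hD : ∀ p ∈ D, z.1 < p.1) :
    FreeState (insert z P) ((L ++ (C ++ D) ++ R).length + 1) ((C ++ D).length + 1) ∨
    (∃ k < D.length, FreeState (insert z P) (L ++ (C ++ D) ++ R).length k ∧
      ∃ l ≤ C.length, LockedState (insert z P) ((L ++ (C ++ D) ++ R).length - 1) l k) ∨
    ∃ l < C.length, FreeState (insert z P) (L ++ (C ++ D) ++ R).length l ∧
      ∃ k ≤ D.length, LockedState (insert z P) ((L ++ (C ++ D) ++ R).length - 1) l k := by
  by_cases hDz : ∃ p ∈ D, p.2 < z.2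
  · exact Or.inr (Or.inl (h.answer_above hz h1 hC hD hDz))
  by_cases hCz : ∃ p ∈ C, z.2 < p.2
  · have h' := h.reflect
    rw [List.map_append, List.reverse_append] at h'
    obtain ⟨l, hl, hf, k, hk, hlk⟩ := h'.answer_above hz.reflect (sub_lt_sub_left h2 1)
      (by rw [forall_mem_reverse_map]; exact fun p hp => sub_lt_sub_left (hD p hp) 1)
      (by rw [forall_mem_reverse_map]; exact fun p hp => sub_lt_sub_left (hC p hp) 1)
      (by
        obtain ⟨p, hp, hpz⟩ := hCz
        exact ⟨_root_.reflect p, List.mem_reverse.2 (List.mem_map_of_mem hp), sub_lt_sub_left hpz 1⟩)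
    have hf := hf.reflect
    have hlk := hlk.reflect
    rw [← preimage_reflect_insert, preimage_reflect_reflect] at hf hlk
    refine Or.inr (Or.inr ⟨l, by simpa using hl, ?_, k, by simpa using hk, ?_⟩)
    · convert hf using 1
      simp; omega
    · convert hlk using 1
      simp; omega
  · push Not at hDz hCz
    refine Or.inl ⟨_, _, _, _, _, h.extend hz h1 h2
      (fun p hp => ⟨hC p hp, lt_of_le_of_ne (hCz p hp) ?_⟩)
      (fun p hp => ⟨hD p hp, lt_of_le_of_ne (hDz p hp) ?_⟩), by simp; omega, by simp; omega⟩
    · exact (hz.1 p (h.mem p (by simp [hp]))).symm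
    · exact hz.1 p (h.mem p (by simp [hp]))

lemma IsLocked.answer_above {P : Set Pt} {ξ ζ : ℝ} {L A B R : List Pt} {a b z : Pt}
    (h : IsLocked P ξ ζ L A B R a b) (hz : Admissible P z) (h1 : ξ < z.1) (h2 : z.1 < ζ)
    (haz : a.2 < z.2) :
    ∃ e ≤ B.length,
      LockedState (insert z P) ((L ++ A ++ (B ++ R)).length + 1 - e) A.length 0 ∧
      (0 < e → LockedState (insert z P) (L ++ A ++ (B ++ R)).length 0 (B.length - e)) := by
  obtain ⟨D, E, rfl, hD, hE⟩ := exists_split_height (C := B) (y := z.2)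
    (by have hc := h.chain; simp only [List.pairwise_append] at hc; exact hc.2.1.1)
    fun p hp => hz.1 p (h.mem p (by simp only [List.mem_append]; tauto))
  refine ⟨D.length, by simp,
    ⟨_, _, _, _, _, _, _, _, h.stay_above hz h1 h2 haz hE, by simp; omega, rfl, rfl⟩,
    fun hpos => ?_⟩
  rcases List.eq_nil_or_concat' D with rfl | ⟨D, d, rfl⟩
  · simp at hpos
  rw [List.append_assoc, List.singleton_append] at h
  obtain ⟨x, hx⟩ := h.move_above hz h1 h2 haz (fun p hp => hD p (by simp [hp]))
    (hD d (by simp)) hE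
  exact ⟨_, _, _, _, _, _, _, _, hx, by simp; omega, rfl, by simp; omega⟩

/-- The two kinds of answers in a locked position. -/
lemma IsLocked.answer {P : Set Pt} {ξ ζ : ℝ} {L A B R : List Pt} {a b z : Pt}
    (h : IsLocked P ξ ζ L A B R a b) (hz : Admissible P z) (h1 : ξ < z.1) (h2 : z.1 < ζ) :
    (∃ e ≤ B.length,
      LockedState (insert z P) ((L ++ A ++ (B ++ R)).length + 1 - e) A.length 0 ∧
      (0 < e → LockedState (insert z P) (L ++ A ++ (B ++ R)).length 0 (B.length - e))) ∨
    ∃ e ≤ A.length,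
      LockedState (insert z P) ((L ++ A ++ (B ++ R)).length + 1 - e) 0 B.length ∧
      (0 < e → LockedState (insert z P) (L ++ A ++ (B ++ R)).length (A.length - e) 0) := by
  rcases lt_or_ge a.2 z.2 with haz | haz
  · exact Or.inl (h.answer_above hz h1 h2 haz)
  have hzb : z.2 < b.2 := by
    by_contra! hbz
    exact hz.2 ⟨a, Or.inr h.mem_a, z, Or.inl rfl, b, Or.inr h.mem_b, h.a_le.trans_lt h1,
      h2.trans_le h.le_b, lt_of_le_of_ne haz (hz.1 a h.mem_a),
      lt_of_le_of_ne hbz (hz.1 b h.mem_b).symm⟩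
  obtain ⟨e, he, hs, hm⟩ := h.reflect.answer_above hz.reflect (sub_lt_sub_left h2 1)
    (sub_lt_sub_left h1 1) (sub_lt_sub_left hzb 1)
  have hs := hs.reflect
  have hm := fun hpos => (hm hpos).reflect
  rw [← preimage_reflect_insert, preimage_reflect_reflect] at hs hm
  refine Or.inr ⟨e, by simpa using he, ?_, fun hpos => ?_⟩
  · convert hs using 1
    · simp; omega
    · simp
  · convert hm hpos using 1
    · simp; omega
    · simp

/-! ### Winning positions -/

/-- One of the two runs sought in the game `A_{m,3}` is present. -/
def Ended (m : ℕ) (P : Set Pt) : Prop := HasUpRun P m ∨ HasDownRun P 3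

/-- Player A can force the end of the game `A_{m,3}` within `j` more turns. -/
def Wins (m : ℕ) : ℕ → Set Pt → Prop
  | 0, P => Ended m P
  | j + 1, P => Ended m P ∨ ∃ x ∈ Ioo (0 : ℝ) 1, (∀ p ∈ P, x ≠ p.1) ∧
      ∀ y ∈ Ioo (0 : ℝ) 1, (∀ p ∈ P, y ≠ p.2) → Wins m j (insert (x, y) P)

lemma Ended.mono {m : ℕ} {P Q : Set Pt} (h : Ended m P) (hPQ : P ⊆ Q) : Ended m Q := by
  rcases h with ⟨f, hf, h⟩ | ⟨f, hf, h⟩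
  · exact Or.inl ⟨f, fun i => hPQ (hf i), h⟩
  · exact Or.inr ⟨f, fun i => hPQ (hf i), h⟩

lemma Ended.wins {m j : ℕ} {P : Set Pt} (h : Ended m P) : Wins m j P := by
  cases j with
  | zero => exact h
  | succ j => exact Or.inl h

lemma HasDescent.ended {m : ℕ} {P : Set Pt} (h : HasDescent P) : Ended m P := by
  obtain ⟨a, ha, b, hb, c, hc, h1, h2, h3, h4⟩ := h
  refine Or.inr ⟨![a, b, c], ?_, ?_, ?_⟩
  · intro i; fin_cases i <;> simpa
  · rw [Fin.strictMono_iff_lt_succ]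
    intro i; fin_cases i <;> simpa
  · rw [Fin.strictAnti_iff_succ_lt]
    intro i; fin_cases i <;> simpa

lemma ended_of_chain {m : ℕ} {P : Set Pt} {l : List Pt} (hl : l.Pairwise Prec)
    (hP : ∀ p ∈ l, p ∈ P) (hm : m ≤ l.length) : Ended m P := by
  have hlt : ∀ i j : Fin m, i < j → Prec (l.get (i.castLE hm)) (l.get (j.castLE hm)) :=
    fun i j hij => List.pairwise_iff_get.1 hl _ _ hij
  refine Or.inl ⟨fun i => l.get (i.castLE hm), fun i => hP _ (l.get_mem _),
    fun i j hij => (hlt i j hij).1, ?_⟩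
  exact StrictMono.monotone fun i j hij => (hlt i j hij).2

/-- Player A may play anywhere in an open interval, up to finitely many abscissae. -/
lemma wins_succ {m j : ℕ} {P : Set Pt} (hP : P.Finite) {u v : ℝ} (huv : u < v) (hu : 0 ≤ u)
    (hv : v ≤ 1) (h : ∀ z : Pt, u < z.1 → z.1 < v → Admissible P z → Wins m j (insert z P)) :
    Wins m (j + 1) P := by
  obtain ⟨x, hx, hxP⟩ := ((Ioo_infinite huv).sdiff (hP.image Prod.fst)).nonempty
  refine Or.inr ⟨x, ⟨hu.trans_lt hx.1, hx.2.trans_le hv⟩, fun p hp he => hxP ⟨p, hp, he.symm⟩,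
    fun y _ hy => ?_⟩
  by_cases hd : HasDescent (insert (x, y) P)
  · exact hd.ended.wins
  · exact h (x, y) hx.1 hx.2 ⟨hy, hd⟩

lemma FreeState.ended {m r n : ℕ} {P : Set Pt} (h : FreeState P r n) (hm : m ≤ r) :
    Ended m P := by
  obtain ⟨ξ, ζ, L, C, R, h, rfl, -⟩ := h
  exact ended_of_chain h.chain h.mem hm

lemma LockedState.ended {m r l k : ℕ} {P : Set Pt} (h : LockedState P r l k) (hm : m ≤ r) :
    Ended m P := by
  obtain ⟨ξ, ζ, L, A, B, R, a, b, h, rfl, -⟩ := h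
  exact ended_of_chain h.chain h.mem hm

/-- A forced win yields a strategy for player A. -/
lemma Wins.exists_strategy {m N : ℕ} (h : Wins m N ∅) : ∃ sA : AStrat, AWinsBy m 3 N sA := by
  have hmove : ∀ l : List Pt, ∃ x, (x ∈ Ioo (0 : ℝ) 1 ∧ ∀ p ∈ l, x ≠ p.1) ∧
      ∀ j, N = l.length + j + 1 → Wins m (j + 1) {p | p ∈ l} →
        ∀ y ∈ Ioo (0 : ℝ) 1, (∀ p ∈ l, y ≠ p.2) → Wins m j (insert (x, y) {p | p ∈ l}) := by
    intro l
    by_cases hl : ∃ j, N = l.length + j + 1 ∧ Wins m (j + 1) {p | p ∈ l} ∧ ¬ Ended m {p | p ∈ l}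
    · obtain ⟨j, hj, hw, he⟩ := hl
      obtain ⟨x, hx, hxl, hy⟩ := hw.resolve_left he
      refine ⟨x, ⟨hx, hxl⟩, fun i hi _ => ?_⟩
      obtain rfl : i = j := by omega
      exact hy
    · obtain ⟨x, hx, hxl⟩ := ((Ioo_infinite (zero_lt_one (α := ℝ))).sdiff
        (l.finite_toSet.image Prod.fst)).nonempty
      refine ⟨x, ⟨hx, fun p hp he => hxl ⟨p, hp, he.symm⟩⟩, fun j hj hw y _ _ => ?_⟩
      push Not at hl
      exact ((hl j hj hw).mono (subset_insert _ _)).wins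
  choose sA hA hw using hmove
  refine ⟨sA, hA, fun sB hB => ?_⟩
  have hlen : ∀ n, (hist sA sB n).length = n := by
    intro n
    induction n with
    | zero => rfl
    | succ n ih => simp [hist, ih]
  have key : ∀ n j, N = n + j → Wins m j (played sA sB n) := by
    intro n
    induction n with
    | zero =>
      rintro j rfl
      simpa [played, hist] using h
    | succ n ih =>
      rintro j hj
      have hn := hw (hist sA sB n) j (by rw [hlen]; omega) (ih (j + 1) (by omega))
        _ (hB _ (sA (hist sA sB n))).1 (hB _ _).2
      convert hn using 1
      ext p
      simp [played, hist, or_comm]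
  exact key N 0 rfl

/-- The winning criterion for locked positions, with `t` wasted turns to spare. -/
lemma LockedState.wins {m j t r l k : ℕ} {P : Set Pt} (hP : P.Finite) (h : LockedState P r l k)
    (hj : m + t ≤ r + j)
    (hlk : l = 0 ∧ k < (t + 2).choose 2 ∨ k = 0 ∧ l < (t + 2).choose 2 ∨
      l ≤ (t + 1).choose 2 ∧ k ≤ (t + 1).choose 2) : Wins m j P := by
  induction j generalizing t r l k P with
  | zero => exact h.ended (by omega)
  | succ j ih =>
    have hpos : ∀ s, 0 < (s + 2).choose 2 := fun s => Nat.choose_pos (by omega)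
    have hsucc : (t + 2).choose 2 = (t + 1) + (t + 1).choose 2 := by
      rw [Nat.choose_succ_succ' (t + 1) 1, Nat.choose_one_right]
    have ht : 0 < t ∨ t = 0 ∧ (t + 1).choose 2 = 0 := by
      rcases Nat.eq_zero_or_pos t with rfl | ht
      · exact Or.inr ⟨rfl, rfl⟩
      · exact Or.inl ht
    have ht' : 0 < t → t - 1 + 2 = t + 1 := by omega
    obtain ⟨ξ, ζ, L, A, B, R, a, b, h, rfl, rfl, rfl⟩ := h
    have hle : A.length + B.length ≤ (L ++ A ++ (B ++ R)).length := by simp; omega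
    refine wins_succ hP h.lt h.nonneg h.le_one fun z h1 h2 hz => ?_
    have hP' := hP.insert z
    have hans := h.answer hz h1 h2
    generalize (L ++ A ++ (B ++ R)).length = r at *
    rcases hans with ⟨e, he, hs, hm⟩ | ⟨e, he, hs, hm⟩
    · by_cases het : e = 0 ∨ A.length = 0 ∧ e ≤ t
      · refine ih hP' hs (t := t - e) (by omega) ?_
        have := hpos (t - e)
        rcases het with rfl | het
        · rw [Nat.sub_zero]; omega
        · omega
      · refine ih hP' (hm (by omega)) (t := t - 1) (by omega) (Or.inl ⟨rfl, ?_⟩)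
        rw [ht' (by omega)]
        omega
    · by_cases het : e = 0 ∨ B.length = 0 ∧ e ≤ t
      · refine ih hP' hs (t := t - e) (by omega) ?_
        have := hpos (t - e)
        rcases het with rfl | het
        · rw [Nat.sub_zero]; omega
        · omega
      · refine ih hP' (hm (by omega)) (t := t - 1) (by omega) (Or.inr (Or.inl ⟨rfl, ?_⟩))
        rw [ht' (by omega)]
        omega

/-- An abscissa interval separating two parts of the up-run of a free position. -/
lemma IsFree.exists_interval {P : Set Pt} {ξ ζ : ℝ} {L C D R : List Pt}
    (h : IsFree P ξ ζ L (C ++ D) R) :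
    ∃ u v, u < v ∧ ξ ≤ u ∧ v ≤ ζ ∧ (∀ p ∈ C, p.1 ≤ u) ∧ ∀ p ∈ D, v ≤ p.1 := by
  obtain ⟨hCc, hDc, hCD⟩ := List.pairwise_append.1
    (List.pairwise_append.1 (List.pairwise_append.1 h.chain).1).2.1
  obtain ⟨u, hξ, huζ, hC, huD⟩ :
      ∃ u, ξ ≤ u ∧ u < ζ ∧ (∀ p ∈ C, p.1 ≤ u) ∧ ∀ p ∈ D, u < p.1 := by
    rcases List.eq_nil_or_concat' C with rfl | ⟨C, c, rfl⟩
    · exact ⟨ξ, le_rfl, h.lt, by simp, fun p hp => (h.inside p (by simp [hp])).1⟩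
    · have hc := h.inside c (by simp)
      refine ⟨c.1, hc.1.le, hc.2, ?_, fun p hp => (hCD c (by simp) p hp).1⟩
      intro p hp
      rcases List.mem_append.1 hp with hp | hp
      · exact ((List.pairwise_append.1 hCc).2.2 p hp c (by simp)).1.le
      · rw [List.mem_singleton.1 hp]
  rcases D with _ | ⟨d, D⟩
  · exact ⟨u, ζ, huζ, hξ, le_rfl, hC, by simp⟩
  · refine ⟨u, d.1, huD d (by simp), hξ, (h.inside d (by simp)).2.le, hC, ?_⟩
    intro p hp
    rcases List.mem_cons.1 hp with rfl | hp
    · exact le_rfl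
    · exact ((List.pairwise_cons.1 hDc).1 p hp).1.le

/-- The winning criterion for free positions, with `c + 1` wasted turns to spare. -/
lemma FreeState.wins {m j c r n : ℕ} {P : Set Pt} (hP : P.Finite) (h : FreeState P r n)
    (hj : m + (c + 1) ≤ r + j) (hn : m + n ≤ r + (1 + 2 * c + (c + 1).choose 3)) :
    Wins m j P := by
  induction j generalizing c r n P with
  | zero => exact h.ended (by omega)
  | succ j ih =>
    by_cases hmr : m ≤ r
    · exact (h.ended hmr).wins
    obtain ⟨ξ, ζ, L, C, R, h, rfl, rfl⟩ := h
    have hr : C.length ≤ (L ++ C ++ R).length := by simp; omega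
    obtain ⟨C, D, rfl, hCl, hDl⟩ : ∃ C' D', C = C' ++ D' ∧ C'.length = C.length / 2 ∧
        D'.length = C.length - C.length / 2 :=
      ⟨_, _, (List.take_append_drop (C.length / 2) C).symm, by simp; omega, by simp⟩
    obtain ⟨u, v, huv, hu, hv, hC, hD⟩ := h.exists_interval
    refine wins_succ hP huv (h.nonneg.trans hu) (hv.trans h.le_one) fun z h1 h2 hz => ?_
    have hP' := hP.insert z
    have hans := h.answer hz (hu.trans_lt h1) (h2.trans_le hv)
      (fun p hp => (hC p hp).trans_lt h1) (fun p hp => h2.trans_le (hD p hp))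
    generalize (L ++ (C ++ D) ++ R).length = r at *
    generalize (C ++ D).length = n at *
    rcases hans with hf | hcover
    · exact ih hP' hf (c := c) (by omega) (by omega)
    obtain ⟨k, hk, hf, l', k', hl'k', hlk⟩ : ∃ k < n, FreeState (insert z P) r k ∧
      ∃ l' k', (2 + (c.choose 2) ≤ n - k ∨ l' ≤ c.choose 2 ∧ k' ≤ c.choose 2) ∧
        LockedState (insert z P) (r - 1) l' k' := by
      rcases hcover with ⟨k, hk, hf, l, hl, hlk⟩ | ⟨l, hl, hf, k, hk, hlk⟩
      · exact ⟨k, by omega, hf, l, k, by omega, hlk⟩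
      · exact ⟨l, by omega, hf, l, k, by omega, hlk⟩
    cases c with
    | zero =>
      have h13 : Nat.choose (0 + 1) 3 = 0 := rfl
      omega
    | succ c =>
      have hsucc : (c + 1 + 1).choose 3 = (c + 1).choose 2 + (c + 1).choose 3 :=
        Nat.choose_succ_succ' (c + 1) 2
      rcases hl'k' with hbig | hsmall
      · exact ih hP' hf (c := c) (by omega) (by omega)
      · exact hlk.wins hP' (t := c) (by omega) (Or.inr (Or.inr hsmall))

lemma freeState_empty : FreeState ∅ 0 0 :=
  ⟨0, 1, [], [], [], by constructor <;> simp, rfl, rfl⟩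

lemma six_mul_choose_three (n : ℕ) : 6 * (n + 2).choose 3 = (n + 2) * (n + 1) * n := by
  rw [show 6 = Nat.factorial 3 from rfl, ← Nat.descFactorial_eq_factorial_mul_choose]
  simp [Nat.descFactorial]; ring

theorem ESO_m3_le_of_least_T (m T : ℕ) (hm : 3 ≤ m)
    (hT : IsLeast {t : ℕ | 0 < t ∧ 6 * (m - 3) ≤ (t - 1) ^ 3 + 17 * (t - 1)} T) :
    ESO m 3 ≤ m + T + 1 := by
  obtain ⟨hpos, hle⟩ := hT.1
  obtain ⟨t, rfl⟩ : ∃ t, T = t + 1 := ⟨T - 1, by omega⟩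
  refine Nat.sInf_le (Wins.exists_strategy (freeState_empty.wins (c := t + 1) finite_empty ?_ ?_))
  · omega
  · have := six_mul_choose_three t
    rw [Nat.add_sub_cancel] at hle
    have h6 : 6 * (m - 3) + 18 = 6 * m := by omega
    show m + 0 ≤ 0 + (1 + 2 * (t + 1) + (t + 2).choose 3)
    have hsq : 3 * t ≤ 3 * (t * t) := by nlinarith [Nat.le_mul_self t]
    nlinarith
end

section
/- Let m and w be positive integers with (w+1)^3 − (w+1) < 6m. Then ESO(m,3) ≥ m + w; that is, player B has a strategy in the game A_{m,3} guaranteeing that, for every strategy of player A, among the first m + w − 1 points played there is neither an m-up-run nor a 3-down-run. -/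
open Set

section Layout

variable {α : Type*} [LinearOrder α]

/-- The number of waiting moves that player B needs on one side of a move in the core in order
to answer it when `r` inversions are still missing. -/
def reserve : ℕ → ℕ
  | 0 => 1
  | r + 1 => reserve r + r

/-- A bound for the number of waiting moves player B makes while at most `r` inversions are
missing, if these phases start with a core of the smallest admissible size. -/
def waits : ℕ → ℕ
  | 0 => 0
  | r + 1 => waits r + reserve (r + 1)

/-- Player B's position after `n` moves, with `r` disjoint inversions still to be created.
The points are split into three rising sets: `M` (waiting moves), `U` (moves lying above waiting
moves to their right) and `L` (moves lying below waiting moves to their left). The points of `U`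
are to the lower left, those of `L` to the upper right of the core
`(xl, xr) × (yl, yr)`, which contains waiting moves only. The set `Q` collects the moves counted
as inversions. -/
structure Layout (lo hi : α) (w T n r : ℕ) (M U L Q : Finset (α × α)) (xl xr yl yr : α) :
    Prop where
  injM : ∀ p ∈ M, ∀ q ∈ M, p.1 = q.1 → p = q
  injL : ∀ p ∈ L, ∀ q ∈ L, p.1 = q.1 → p = q
  injU : ∀ p ∈ U, ∀ q ∈ U, p.1 = q.1 → p = q
  riseM : ∀ p ∈ M, ∀ q ∈ M, p.1 < q.1 → p.2 < q.2
  riseU : ∀ p ∈ U, ∀ q ∈ U, p.1 < q.1 → p.2 < q.2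
  riseL : ∀ p ∈ L, ∀ q ∈ L, p.1 < q.1 → p.2 < q.2
  leU : ∀ p ∈ U, p.1 ≤ xl ∧ p.2 ≤ yl
  geL : ∀ p ∈ L, xr ≤ p.1 ∧ yr ≤ p.2
  ltx : xl < xr
  lty : yl < yr
  loy : lo ≤ yl
  hiy : yr ≤ hi
  loU : ∀ p ∈ U, lo < p.2
  hiL : ∀ p ∈ L, p.2 < hi
  botx : xl ≤ lo ∨ ∃ p ∈ M, p.1 = xl
  topx : hi ≤ xr ∨ ∃ p ∈ M, p.1 = xr
  leftM : ∀ p ∈ M, p.1 ≤ xl → p.2 ≤ yl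
  rightM : ∀ p ∈ M, xr ≤ p.1 → yr ≤ p.2
  coreL : ∀ p ∈ M, xl < p.1 → yl < p.2
  coreR : ∀ p ∈ M, p.1 < xr → p.2 < yr
  degU : ∀ q ∈ U, r ≤ (M.filter fun p => q.1 < p.1 ∧ p.2 < q.2).card
  degL : ∀ q ∈ L, r ≤ (M.filter fun p => p.1 < q.1 ∧ q.2 < p.2).card
  size : reserve r ≤ (M.filter fun p => xl < p.1 ∧ p.1 < xr).card + 1 ∨ xl ≤ lo ∧ hi ≤ xr
  subQ : ∀ q ∈ Q, (q ∈ U ∨ q ∈ L) ∧ q ∉ M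
  cardQ : Q.card + r = w
  miss : ∀ I : Finset (α × α), (∀ p ∈ I, ∀ q ∈ I, p.1 < q.1 → p.2 ≤ q.2) →
    (Q ∩ I).Nonempty → r + (Q ∩ I).card ≤ (M \ I).card
  time : 1 ≤ r → n + r + waits r + reserve r ≤
    T + (M.filter fun p => xl < p.1 ∧ p.1 < xr).card + 1
  time' : 1 ≤ r → n + r + waits (r - 1) ≤ T

/-- Against the move `x`, player B has an answer outside `Y` that leads to a layout again. -/
def Answerable (lo hi : α) (w T n : ℕ) (M U L : Finset (α × α)) (Y : Finset α) (x : α) : Prop :=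
  ∃ y, lo < y ∧ y < hi ∧ y ∉ Y ∧ ∃ r M' U' L' Q' xl xr yl yr,
    Layout lo hi w T (n + 1) r M' U' L' Q' xl xr yl yr ∧
    ∀ p, (p ∈ M' ∨ p ∈ U' ∨ p ∈ L') ↔ (p = (x, y) ∨ p ∈ M ∨ p ∈ U ∨ p ∈ L)

variable {lo hi : α} {w T n r : ℕ} {M U L Q : Finset (α × α)} {xl xr yl yr x : α} {Y : Finset α}

theorem Layout.dual (h : Layout lo hi w T n r M U L Q xl xr yl yr) :
    Layout (α := αᵒᵈ) hi lo w T n r M L U Q xr xl yr yl where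
  injM := h.injM
  injL := h.injU
  injU := h.injL
  riseM p hp q hq := h.riseM q hq p hp
  riseU p hp q hq := h.riseL q hq p hp
  riseL p hp q hq := h.riseU q hq p hp
  leU := h.geL
  geL := h.leU
  ltx := h.ltx
  lty := h.lty
  loy := h.hiy
  hiy := h.loy
  loU := h.hiL
  hiL := h.loU
  botx := h.topx
  topx := h.botx
  leftM := h.rightM
  rightM := h.leftM
  coreL := h.coreR
  coreR := h.coreL
  degU := h.degL
  degL := h.degU
  size := by
    have := h.size
    simp only [and_comm (a := xl < _)] at this
    exact this.imp_right And.symm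
  subQ q hq := ⟨(h.subQ q hq).1.symm, (h.subQ q hq).2⟩
  cardQ := h.cardQ
  miss I hI := h.miss I fun p hp q hq => hI q hq p hp
  time := by
    have := h.time
    simp only [and_comm (a := xl < _)] at this
    exact this
  time' := h.time'

theorem Answerable.dual
    (h : Answerable (α := αᵒᵈ) hi lo w T n M L U Y x) : Answerable lo hi w T n M U L Y x := by
  obtain ⟨y, h1, h2, h3, r, M', U', L', Q', xl, xr, yl, yr, h4, h5⟩ := h
  refine ⟨y, h2, h1, h3, r, M', L', U', Q', xr, xl, yr, yl, h4.dual, fun p => ?_⟩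
  exact ((Iff.rfl.or or_comm).trans (h5 p)).trans (Iff.rfl.or (Iff.rfl.or or_comm))

theorem reserve_pos (r : ℕ) : 1 ≤ reserve r := by
  induction r with
  | zero => exact le_rfl
  | succ r ih => exact ih.trans (Nat.le_add_right _ _)

theorem le_reserve (r : ℕ) : r ≤ reserve r := by
  induction r with
  | zero => exact Nat.zero_le _
  | succ r ih =>
    rcases r with _ | r
    · decide
    · have := reserve_pos (r + 1)
      simp only [reserve] at *
      omega

theorem reserve_pred_add (r : ℕ) : reserve (r - 1) + max r 1 = reserve r + 1 := by
  rcases r with _ | r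
  · rfl
  · simp only [reserve, Nat.add_sub_cancel]
    omega

theorem waits_pred_add (hr : 1 ≤ r) : waits (r - 1) + reserve r = waits r := by
  obtain ⟨r, rfl⟩ := Nat.exists_eq_add_of_le' hr
  rfl

theorem six_mul_waits_add_reserve (w : ℕ) :
    6 * (waits w + reserve w) = w * (w + 1) * (w + 2) + 6 := by
  have key : ∀ r, 2 * reserve r + r = r * r + 2 := by
    intro r
    induction r with
    | zero => rfl
    | succ r ih => simp only [reserve]; linarith
  have key' : ∀ r, 6 * waits r = r * r * r + 5 * r := by
    intro r
    induction r with
    | zero => rfl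
    | succ r ih => simp only [waits]; linarith [key (r + 1)]
  linarith [key w, key' w]

/-- Between two finite sets, infinitely many points can be found in a dense order. -/
theorem exists_between_avoiding [DenselyOrdered α] (A B Y : Finset α) (hA : A.Nonempty)
    (hB : B.Nonempty) (h : ∀ a ∈ A, ∀ b ∈ B, a < b) :
    ∃ y, (∀ a ∈ A, a < y) ∧ (∀ b ∈ B, y < b) ∧ y ∉ Y := by
  have hlt : A.max' hA < B.min' hB := h _ (A.max'_mem hA) _ (B.min'_mem hB)
  obtain ⟨y, hy, hyY⟩ := (Set.Ioo_infinite hlt).exists_notMem_finset Y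
  exact ⟨y, fun a ha => (A.le_max' a ha).trans_lt hy.1,
    fun b hb => hy.2.trans_le (B.min'_le b hb), hyY⟩

/-- The `c` rightmost points of a finite set with distinct `x`-coordinates. -/
theorem exists_card_filter_fst_ge (s : Finset (α × α))
    (hs : ∀ p ∈ s, ∀ q ∈ s, p.1 = q.1 → p = q) {c : ℕ} (hc : 1 ≤ c) (hcs : c ≤ s.card) :
    ∃ a ∈ s, (s.filter fun p => a.1 ≤ p.1).card = c := by
  induction hk : s.card - c generalizing s with
  | zero =>
    obtain ⟨a, ha, hmin⟩ := s.exists_min_image Prod.fst (Finset.card_pos.1 (by omega))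
    refine ⟨a, ha, ?_⟩
    rw [Finset.filter_true_of_mem hmin]
    omega
  | succ k ih =>
    obtain ⟨a, ha, hmin⟩ := s.exists_min_image Prod.fst (Finset.card_pos.1 (by omega))
    have hcard := Finset.card_erase_of_mem ha
    obtain ⟨b, hb, hbc⟩ := ih (s.erase a)
      (fun p hp q hq => hs p (Finset.mem_of_mem_erase hp) q (Finset.mem_of_mem_erase hq))
      (by omega) (by omega)
    have hbs := Finset.mem_of_mem_erase hb
    have hab : a.1 < b.1 := lt_of_le_of_ne (hmin b hbs)
      fun e => Finset.ne_of_mem_erase hb (hs a ha b hbs e).symm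
    refine ⟨b, hbs, ?_⟩
    rw [← hbc, Finset.filter_erase, Finset.erase_eq_of_notMem]
    simp [hab]

theorem Layout.exists_extend (h : Layout lo hi w T n r M U L Q xl xr yl yr) {q : α × α}
    (hq : q ∉ Q) (hdeg : r ≤ (M.filter fun p => p.1 < q.1 ∧ q.2 < p.2).card) :
    ∃ Q', (∀ p ∈ Q', p = q ∨ p ∈ Q) ∧ Q'.card + (r - 1) = w ∧
      ∀ I : Finset (α × α), (∀ p ∈ I, ∀ q ∈ I, p.1 < q.1 → p.2 ≤ q.2) →
        (Q' ∩ I).Nonempty → r - 1 + (Q' ∩ I).card ≤ (M \ I).card := by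
  rcases Nat.eq_zero_or_pos r with rfl | hr
  · exact ⟨Q, fun p hp => Or.inr hp, h.cardQ, h.miss⟩
  refine ⟨insert q Q, fun p hp => Finset.mem_insert.1 hp, ?_, fun I hI hne => ?_⟩
  · rw [Finset.card_insert_of_notMem hq]
    have := h.cardQ
    omega
  by_cases hqI : q ∈ I
  · rw [Finset.insert_inter_of_mem hqI, Finset.card_insert_of_notMem (by simp [hq])]
    rcases (Q ∩ I).eq_empty_or_nonempty with he | hne'
    · have : (M.filter fun p => p.1 < q.1 ∧ q.2 < p.2) ⊆ M \ I := by
        intro p hp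
        obtain ⟨hpM, hp1, hp2⟩ := Finset.mem_filter.1 hp
        exact Finset.mem_sdiff.2 ⟨hpM, fun hpI => (hI p hpI q hqI hp1).not_gt hp2⟩
      have := Finset.card_le_card this
      rw [he, Finset.card_empty]
      omega
    · have := h.miss I hI hne'
      omega
  · rw [Finset.insert_inter_of_notMem hqI] at hne ⊢
    have := h.miss I hI hne
    omega

/-- Answer with a new point of `L` when enough waiting moves lie to the left of `x`. -/
theorem Layout.answerable_below [DenselyOrdered α] (h : Layout lo hi w T n r M U L Q xl xr yl yr)
    (hx : ∀ p, p ∈ M ∨ p ∈ U ∨ p ∈ L → p.1 ≠ x) (hhi : x < hi)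
    (hL : ∀ p ∈ L, x < p.1)
    (hs : reserve r ≤ (M.filter fun p => xl < p.1 ∧ p.1 < x).card) :
    Answerable lo hi w T n M U L Y x := by
  set s := M.filter fun p => xl < p.1 ∧ p.1 < x with hsdef
  have hsM : ∀ p ∈ s, p ∈ M := fun p hp => (Finset.mem_filter.1 hp).1
  obtain ⟨a, ha, hac⟩ := exists_card_filter_fst_ge s
    (fun p hp q hq => h.injM p (hsM p hp) q (hsM q hq)) (le_max_right r 1)
    ((max_le (le_reserve r) (reserve_pos r)).trans hs)
  obtain ⟨haM, hax, hax'⟩ := Finset.mem_filter.1 ha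
  obtain ⟨y, hyA, hyB, hyY⟩ := exists_between_avoiding
    (insert yl ((M.filter fun p => p.1 < min xr a.1).image Prod.snd)) {yr, a.2} Y
    (Finset.insert_nonempty _ _) (Finset.insert_nonempty _ _) (by
      intro u hu v hv
      rcases Finset.mem_insert.1 hu with rfl | hu
      · rcases Finset.mem_insert.1 hv with rfl | hv
        · exact h.lty
        · rw [Finset.mem_singleton.1 hv]
          exact h.coreL a haM hax
      · obtain ⟨p, hp, rfl⟩ := Finset.mem_image.1 hu
        obtain ⟨hpM, hp1⟩ := Finset.mem_filter.1 hp
        rcases Finset.mem_insert.1 hv with rfl | hv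
        · exact h.coreR p hpM (hp1.trans_le (min_le_left _ _))
        · rw [Finset.mem_singleton.1 hv]
          exact h.riseM p hpM a haM (hp1.trans_le (min_le_right _ _)))
  have hyl : yl < y := hyA _ (Finset.mem_insert_self _ _)
  have hyM : ∀ p ∈ M, p.1 < min xr a.1 → p.2 < y := fun p hp hlt =>
    hyA _ (Finset.mem_insert_of_mem
      (Finset.mem_image_of_mem _ (Finset.mem_filter.2 ⟨hp, hlt⟩)))
  have hyr : y < yr := hyB _ (by simp)
  have hya : y < a.2 := hyB _ (by simp)
  have hyaM : ∀ p ∈ M, a.1 ≤ p.1 → y < p.2 := by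
    intro p hp hle
    rcases hle.eq_or_lt with e | hlt
    · rwa [← h.injM a haM p hp e]
    · exact hya.trans (h.riseM a haM p hp hlt)
  have hnew : ∀ p, p ∈ M ∨ p ∈ U ∨ p ∈ L → p ≠ (x, y) := fun p hp e =>
    hx p hp (by rw [e])
  have hdeg : r ≤ (M.filter fun p => p.1 < x ∧ y < p.2).card := by
    refine (le_max_left r 1).trans (hac.ge.trans (Finset.card_le_card fun p hp => ?_))
    obtain ⟨hps, hp1⟩ := Finset.mem_filter.1 hp
    obtain ⟨hpM, -, hp2⟩ := Finset.mem_filter.1 hps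
    exact Finset.mem_filter.2 ⟨hpM, hp2, hyaM p hpM hp1⟩
  have hsize : reserve (r - 1) ≤
      (M.filter fun p => xl < p.1 ∧ p.1 < min xr a.1).card + 1 := by
    have hred := reserve_pred_add r
    rcases le_total xr a.1 with hle | hle
    · rw [min_eq_left hle]
      have := h.size.resolve_right fun ⟨_, h'⟩ => (h'.trans (hle.trans hax'.le)).not_gt hhi
      omega
    · rw [min_eq_right hle]
      have hsplit := Finset.card_filter_add_card_filter_not (s := s) (fun p => a.1 ≤ p.1)
      have : (s.filter fun p => ¬ a.1 ≤ p.1) ⊆ M.filter fun p => xl < p.1 ∧ p.1 < a.1 := by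
        intro p hp
        obtain ⟨hps, hp1⟩ := Finset.mem_filter.1 hp
        obtain ⟨hpM, hp2, -⟩ := Finset.mem_filter.1 hps
        exact Finset.mem_filter.2 ⟨hpM, hp2, not_le.1 hp1⟩
      have := Finset.card_le_card this
      omega
  obtain ⟨Q', hQ', hcard, hmiss⟩ := h.exists_extend (q := (x, y))
    (fun hq => hnew _ (Or.inr (h.subQ _ hq).1) rfl) hdeg
  refine ⟨y, h.loy.trans_lt hyl, hyr.trans_le h.hiy, hyY, r - 1, M, U, insert (x, y) L, Q',
    xl, min xr a.1, yl, y, ?_, fun p => by simp only [Finset.mem_insert]; tauto⟩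
  refine
    { injM := h.injM, injL := ?_, injU := h.injU, riseM := h.riseM, riseU := h.riseU,
      leU := h.leU, loy := h.loy,
      loU := h.loU, botx := h.botx, leftM := h.leftM, coreL := h.coreL, cardQ := hcard,
      lty := hyl, coreR := hyM, size := Or.inl hsize, miss := hmiss, riseL := ?_, geL := ?_,
      ltx := ?_,
      hiy := ?_, hiL := ?_, topx := ?_, rightM := ?_, degU := ?_, degL := ?_, subQ := ?_,
      time := ?_, time' := ?_ }
  · intro p hp q hq e
    rcases Finset.mem_insert.1 hp with rfl | hp <;> rcases Finset.mem_insert.1 hq with rfl | hq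
    · rfl
    · exact absurd e.symm (hx q (Or.inr (Or.inr hq)))
    · exact absurd e (hx p (Or.inr (Or.inr hp)))
    · exact h.injL p hp q hq e
  · intro p hp q hq hlt
    rcases Finset.mem_insert.1 hp with rfl | hp <;> rcases Finset.mem_insert.1 hq with rfl | hq
    · exact absurd hlt (lt_irrefl _)
    · exact hyr.trans_le (h.geL q hq).2
    · exact absurd (hL p hp) hlt.not_gt
    · exact h.riseL p hp q hq hlt
  · intro p hp
    rcases Finset.mem_insert.1 hp with rfl | hp
    · exact ⟨(min_le_right _ _).trans hax'.le, le_rfl⟩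
    · exact ⟨(min_le_left _ _).trans (h.geL p hp).1, hyr.le.trans (h.geL p hp).2⟩
  · exact lt_min h.ltx hax
  · exact hyr.le.trans h.hiy
  · intro p hp
    rcases Finset.mem_insert.1 hp with rfl | hp
    · exact hyr.trans_le h.hiy
    · exact h.hiL p hp
  · rcases le_total xr a.1 with hle | hle
    · rw [min_eq_left hle]
      exact h.topx
    · rw [min_eq_right hle]
      exact Or.inr ⟨a, haM, rfl⟩
  · intro p hp hle
    rcases min_le_iff.1 hle with hle | hle
    · exact hyr.le.trans (h.rightM p hp hle)
    · exact (hyaM p hp hle).le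
  · exact fun q hq => (Nat.sub_le _ _).trans (h.degU q hq)
  · intro q hq
    rcases Finset.mem_insert.1 hq with rfl | hq
    · exact (Nat.sub_le _ _).trans hdeg
    · exact (Nat.sub_le _ _).trans (h.degL q hq)
  · intro q hq
    rcases hQ' q hq with rfl | hq
    · exact ⟨Or.inr (Finset.mem_insert_self _ _), fun hM => hnew _ (Or.inl hM) rfl⟩
    · exact ⟨(h.subQ q hq).1.imp_right (Finset.mem_insert_of_mem), (h.subQ q hq).2⟩
  · intro hr
    have := h.time' (by omega)
    omega
  · intro hr
    have := h.time' (by omega)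
    have := waits_pred_add hr
    omega

/-- Answer with a twin of the last point of `L` to the left of `x`. -/
theorem Layout.answerable_twin [DenselyOrdered α] (h : Layout lo hi w T n r M U L Q xl xr yl yr)
    (hx : ∀ p, p ∈ M ∨ p ∈ U ∨ p ∈ L → p.1 ≠ x) (hhi : x < hi)
    (hL : ∃ p ∈ L, p.1 < x) :
    Answerable lo hi w T n M U L Y x := by
  obtain ⟨b, hb, hbmax⟩ := (L.filter fun p => p.1 < x).exists_max_image Prod.fst
    (hL.imp fun p hp => Finset.mem_filter.2 hp)
  obtain ⟨hbL, hbx⟩ := Finset.mem_filter.1 hb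
  obtain ⟨hb1, hb2⟩ := h.geL b hbL
  obtain ⟨y, hyA, hyB, hyY⟩ := exists_between_avoiding {b.2}
    (insert hi (((M ∪ L).image Prod.snd).filter fun v => b.2 < v)) Y
    (Finset.singleton_nonempty _) (Finset.insert_nonempty _ _) (by
      intro u hu v hv
      rw [Finset.mem_singleton.1 hu]
      rcases Finset.mem_insert.1 hv with rfl | hv
      · exact h.hiL b hbL
      · exact (Finset.mem_filter.1 hv).2)
  have hby : b.2 < y := hyA _ (Finset.mem_singleton_self _)
  have hyhi : y < hi := hyB _ (Finset.mem_insert_self _ _)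
  have hyML : ∀ p, p ∈ M ∨ p ∈ L → b.2 < p.2 → y < p.2 := fun p hp hlt =>
    hyB _ (Finset.mem_insert_of_mem (Finset.mem_filter.2
      ⟨Finset.mem_image_of_mem _ (Finset.mem_union.2 hp), hlt⟩))
  have hnew : ∀ p, p ∈ M ∨ p ∈ U ∨ p ∈ L → p ≠ (x, y) := fun p hp e =>
    hx p hp (by rw [e])
  have hdeg : r ≤ (M.filter fun p => p.1 < x ∧ y < p.2).card := by
    refine (h.degL b hbL).trans (Finset.card_le_card fun p hp => ?_)
    obtain ⟨hpM, hp1, hp2⟩ := Finset.mem_filter.1 hp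
    exact Finset.mem_filter.2 ⟨hpM, hp1.trans hbx, hyML p (Or.inl hpM) hp2⟩
  have hsize : reserve (r - 1) ≤ (M.filter fun p => xl < p.1 ∧ p.1 < xr).card + 1 := by
    have := h.size.resolve_right fun ⟨_, h'⟩ => (h'.trans (hb1.trans hbx.le)).not_gt hhi
    have := reserve_pred_add r
    omega
  obtain ⟨Q', hQ', hcard, hmiss⟩ := h.exists_extend (q := (x, y))
    (fun hq => hnew _ (Or.inr (h.subQ _ hq).1) rfl) hdeg
  refine ⟨y, (h.loy.trans_lt h.lty).trans_le (hb2.trans hby.le), hyhi, hyY, r - 1, M, U,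
    insert (x, y) L, Q', xl, xr, yl, yr, ?_, fun p => by simp only [Finset.mem_insert]; tauto⟩
  refine
    { h with
      injL := ?_, cardQ := hcard, size := Or.inl hsize, miss := hmiss, riseL := ?_,
      geL := ?_, hiL := ?_,
      degU := ?_, degL := ?_, subQ := ?_, time := ?_, time' := ?_ }
  · intro p hp q hq e
    rcases Finset.mem_insert.1 hp with rfl | hp <;> rcases Finset.mem_insert.1 hq with rfl | hq
    · rfl
    · exact absurd e.symm (hx q (Or.inr (Or.inr hq)))
    · exact absurd e (hx p (Or.inr (Or.inr hp)))
    · exact h.injL p hp q hq e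
  · intro p hp q hq hlt
    rcases Finset.mem_insert.1 hp with rfl | hp <;> rcases Finset.mem_insert.1 hq with rfl | hq
    · exact absurd hlt (lt_irrefl _)
    · exact hyML q (Or.inr hq) (h.riseL b hbL q hq (hbx.trans hlt))
    · refine lt_of_le_of_lt ?_ hby
      rcases (hbmax p (Finset.mem_filter.2 ⟨hp, hlt⟩)).eq_or_lt with e | hlt'
      · exact (congrArg Prod.snd (h.injL p hp b hbL e)).le
      · exact (h.riseL p hp b hbL hlt').le
    · exact h.riseL p hp q hq hlt
  · intro p hp
    rcases Finset.mem_insert.1 hp with rfl | hp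
    · exact ⟨hb1.trans hbx.le, hb2.trans hby.le⟩
    · exact h.geL p hp
  · intro p hp
    rcases Finset.mem_insert.1 hp with rfl | hp
    · exact hyhi
    · exact h.hiL p hp
  · exact fun q hq => (Nat.sub_le _ _).trans (h.degU q hq)
  · intro q hq
    rcases Finset.mem_insert.1 hq with rfl | hq
    · exact (Nat.sub_le _ _).trans hdeg
    · exact (Nat.sub_le _ _).trans (h.degL q hq)
  · intro q hq
    rcases hQ' q hq with rfl | hq
    · exact ⟨Or.inr (Finset.mem_insert_self _ _), fun hM => hnew _ (Or.inl hM) rfl⟩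
    · exact ⟨(h.subQ q hq).1.imp_right (Finset.mem_insert_of_mem), (h.subQ q hq).2⟩
  · intro hr
    have := h.time' (by omega)
    omega
  · intro hr
    have := h.time' (by omega)
    have := waits_pred_add hr
    omega

/-- Answer with a waiting move in the core. -/
theorem Layout.answerable_wait [DenselyOrdered α] (h : Layout lo hi w T n r M U L Q xl xr yl yr)
    (hx : ∀ p, p ∈ M ∨ p ∈ U ∨ p ∈ L → p.1 ≠ x) (hxl : xl < x) (hxr : x < xr)
    (hs : (M.filter fun p => xl < p.1 ∧ p.1 < xr).card + 1 < 2 * reserve r) :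
    Answerable lo hi w T n M U L Y x := by
  obtain ⟨y, hyA, hyB, hyY⟩ := exists_between_avoiding
    (insert yl ((M.filter fun p => p.1 < x).image Prod.snd))
    (insert yr ((M.filter fun p => x < p.1).image Prod.snd)) Y
    (Finset.insert_nonempty _ _) (Finset.insert_nonempty _ _) (by
      intro u hu v hv
      rcases Finset.mem_insert.1 hu with rfl | hu <;> rcases Finset.mem_insert.1 hv with rfl | hv
      · exact h.lty
      · obtain ⟨p, hp, rfl⟩ := Finset.mem_image.1 hv
        obtain ⟨hpM, hp1⟩ := Finset.mem_filter.1 hp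
        exact h.coreL p hpM (hxl.trans hp1)
      · obtain ⟨p, hp, rfl⟩ := Finset.mem_image.1 hu
        obtain ⟨hpM, hp1⟩ := Finset.mem_filter.1 hp
        exact h.coreR p hpM (hp1.trans hxr)
      · obtain ⟨p, hp, rfl⟩ := Finset.mem_image.1 hu
        obtain ⟨q, hq, rfl⟩ := Finset.mem_image.1 hv
        obtain ⟨hpM, hp1⟩ := Finset.mem_filter.1 hp
        obtain ⟨hqM, hq1⟩ := Finset.mem_filter.1 hq
        exact h.riseM p hpM q hqM (hp1.trans hq1))
  have hyl : yl < y := hyA _ (Finset.mem_insert_self _ _)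
  have hyr : y < yr := hyB _ (Finset.mem_insert_self _ _)
  have hyL : ∀ p ∈ M, p.1 < x → p.2 < y := fun p hp hlt =>
    hyA _ (Finset.mem_insert_of_mem
      (Finset.mem_image_of_mem _ (Finset.mem_filter.2 ⟨hp, hlt⟩)))
  have hyR : ∀ p ∈ M, x < p.1 → y < p.2 := fun p hp hlt =>
    hyB _ (Finset.mem_insert_of_mem
      (Finset.mem_image_of_mem _ (Finset.mem_filter.2 ⟨hp, hlt⟩)))
  have hnew : ∀ p, p ∈ M ∨ p ∈ U ∨ p ∈ L → p ≠ (x, y) := fun p hp e =>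
    hx p hp (by rw [e])
  have hcore : ((insert (x, y) M).filter fun p => xl < p.1 ∧ p.1 < xr).card =
      (M.filter fun p => xl < p.1 ∧ p.1 < xr).card + 1 := by
    rw [Finset.filter_insert, if_pos ⟨hxl, hxr⟩, Finset.card_insert_of_notMem]
    exact fun hM => hnew _ (Or.inl (Finset.mem_filter.1 hM).1) rfl
  have hsub : M ⊆ insert (x, y) M := Finset.subset_insert _ _
  refine ⟨y, h.loy.trans_lt hyl, hyr.trans_le h.hiy, hyY, r, insert (x, y) M, U, L, Q,
    xl, xr, yl, yr, ?_, fun p => by simp only [Finset.mem_insert]; tauto⟩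
  refine
    { h with
      injM := ?_, riseM := ?_, botx := ?_, topx := ?_, leftM := ?_, rightM := ?_, coreL := ?_,
      coreR := ?_, degU := ?_, degL := ?_, size := ?_, subQ := ?_, miss := ?_, time := ?_,
      time' := ?_ }
  · intro p hp q hq e
    rcases Finset.mem_insert.1 hp with rfl | hp <;> rcases Finset.mem_insert.1 hq with rfl | hq
    · rfl
    · exact absurd e.symm (hx q (Or.inl hq))
    · exact absurd e (hx p (Or.inl hp))
    · exact h.injM p hp q hq e
  · intro p hp q hq hlt
    rcases Finset.mem_insert.1 hp with rfl | hp <;> rcases Finset.mem_insert.1 hq with rfl | hq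
    · exact absurd hlt (lt_irrefl _)
    · exact hyR q hq hlt
    · exact hyL p hp hlt
    · exact h.riseM p hp q hq hlt
  · exact h.botx.imp_right fun ⟨p, hp, e⟩ => ⟨p, hsub hp, e⟩
  · exact h.topx.imp_right fun ⟨p, hp, e⟩ => ⟨p, hsub hp, e⟩
  · intro p hp hle
    rcases Finset.mem_insert.1 hp with rfl | hp
    · exact absurd hxl hle.not_gt
    · exact h.leftM p hp hle
  · intro p hp hle
    rcases Finset.mem_insert.1 hp with rfl | hp
    · exact absurd hxr hle.not_gt
    · exact h.rightM p hp hle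
  · intro p hp hlt
    rcases Finset.mem_insert.1 hp with rfl | hp
    · exact hyl
    · exact h.coreL p hp hlt
  · intro p hp hlt
    rcases Finset.mem_insert.1 hp with rfl | hp
    · exact hyr
    · exact h.coreR p hp hlt
  · exact fun q hq => (h.degU q hq).trans
      (Finset.card_le_card (Finset.filter_subset_filter _ hsub))
  · exact fun q hq => (h.degL q hq).trans
      (Finset.card_le_card (Finset.filter_subset_filter _ hsub))
  · exact h.size.imp_left fun h' => by omega
  · intro q hq
    refine ⟨(h.subQ q hq).1, fun hM => ?_⟩
    rcases Finset.mem_insert.1 hM with rfl | hM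
    · exact hnew _ (Or.inr (h.subQ _ hq).1) rfl
    · exact (h.subQ q hq).2 hM
  · exact fun I hI hne => (h.miss I hI hne).trans
      (Finset.card_le_card (Finset.sdiff_subset_sdiff hsub le_rfl))
  · intro hr
    have := h.time hr
    omega
  · intro hr
    have := h.time hr
    have := waits_pred_add hr
    omega

/-- Every move outside the core, to its right, can be answered. -/
theorem Layout.answerable_right [DenselyOrdered α] (h : Layout lo hi w T n r M U L Q xl xr yl yr)
    (hx : ∀ p, p ∈ M ∨ p ∈ U ∨ p ∈ L → p.1 ≠ x) (hxr : xr ≤ x) (hhi : x < hi) :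
    Answerable lo hi w T n M U L Y x := by
  by_cases hL : ∃ p ∈ L, p.1 < x
  · exact h.answerable_twin hx hhi hL
  push Not at hL
  obtain ⟨a, haM, hax⟩ := h.topx.resolve_left fun hle => (hle.trans hxr).not_gt hhi
  have hxr' : xr < x := lt_of_le_of_ne hxr fun e => hx a (Or.inl haM) (hax.trans e)
  refine h.answerable_below hx hhi
    (fun p hp => lt_of_le_of_ne (hL p hp) (hx p (Or.inr (Or.inr hp))).symm) ?_
  have hsub : insert a (M.filter fun p => xl < p.1 ∧ p.1 < xr) ⊆
      M.filter fun p => xl < p.1 ∧ p.1 < x := by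
    intro p hp
    rcases Finset.mem_insert.1 hp with rfl | hp
    · exact Finset.mem_filter.2 ⟨haM, hax ▸ h.ltx, hax ▸ hxr'⟩
    · obtain ⟨hpM, hp1, hp2⟩ := Finset.mem_filter.1 hp
      exact Finset.mem_filter.2 ⟨hpM, hp1, hp2.trans hxr'⟩
  have := Finset.card_le_card hsub
  rw [Finset.card_insert_of_notMem (by simp [hax])] at this
  exact (h.size.resolve_right fun ⟨_, h'⟩ => (h'.trans hxr).not_gt hhi).trans this

theorem Layout.answerable [DenselyOrdered α] (h : Layout lo hi w T n r M U L Q xl xr yl yr)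
    (hx : ∀ p, p ∈ M ∨ p ∈ U ∨ p ∈ L → p.1 ≠ x) (hlo : lo < x) (hhi : x < hi) :
    Answerable lo hi w T n M U L Y x := by
  have hx' : ∀ p, p ∈ M ∨ p ∈ L ∨ p ∈ U → p.1 ≠ x := fun p hp =>
    hx p (hp.imp_right Or.symm)
  rcases le_or_gt xr x with hxr | hxr
  · exact h.answerable_right hx hxr hhi
  rcases le_or_gt x xl with hxl | hxl
  · exact (h.dual.answerable_right hx' hxl hlo).dual
  by_cases hs : (M.filter fun p => xl < p.1 ∧ p.1 < xr).card + 1 < 2 * reserve r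
  · exact h.answerable_wait hx hxl hxr hs
  have hsub : (M.filter fun p => xl < p.1 ∧ p.1 < xr) ⊆
      (M.filter fun p => xl < p.1 ∧ p.1 < x) ∪ M.filter fun p => p.1 < xr ∧ x < p.1 := by
    intro p hp
    obtain ⟨hpM, hp1, hp2⟩ := Finset.mem_filter.1 hp
    rcases (hx p (Or.inl hpM)).lt_or_gt with hlt | hlt
    · exact Finset.mem_union_left _ (Finset.mem_filter.2 ⟨hpM, hp1, hlt⟩)
    · exact Finset.mem_union_right _ (Finset.mem_filter.2 ⟨hpM, hp2, hlt⟩)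
  have hcard := (Finset.card_le_card hsub).trans (Finset.card_union_le _ _)
  by_cases hs' : reserve r ≤ (M.filter fun p => xl < p.1 ∧ p.1 < x).card
  · exact h.answerable_below hx hhi (fun p hp => hxr.trans_le (h.geL p hp).1) hs'
  · have hs'' : reserve r ≤ (M.filter fun p => p.1 < xr ∧ x < p.1).card := by omega
    exact (h.dual.answerable_below hx' hlo (fun p hp => (h.leU p hp).1.trans_lt hxl) hs'').dual

theorem layout_empty (h : lo < hi) :
    Layout lo hi w (w + waits w + reserve w - 1) 0 w ∅ ∅ ∅ ∅ lo hi lo hi := by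
  have := reserve_pos w
  constructor <;> simp [h]
  · omega
  · intro hw
    have := waits_pred_add hw
    omega

/-- A rising set misses at least `w` points of a layout with no missing inversions. -/
theorem Layout.card_add_le (h : Layout lo hi w T n 0 M U L Q xl xr yl yr) {P I : Finset (α × α)}
    (hP : ∀ p, p ∈ M ∨ p ∈ U ∨ p ∈ L → p ∈ P) (hIP : I ⊆ P)
    (hI : ∀ p ∈ I, ∀ q ∈ I, p.1 < q.1 → p.2 ≤ q.2) : I.card + w ≤ P.card := by
  have hdisj : Disjoint (M \ I) (Q \ I) := Finset.disjoint_left.2 fun p hp hq =>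
    (h.subQ p (Finset.mem_sdiff.1 hq).1).2 (Finset.mem_sdiff.1 hp).1
  have hsub : (M \ I) ∪ (Q \ I) ⊆ P \ I := by
    intro p hp
    rcases Finset.mem_union.1 hp with hp | hp <;> obtain ⟨hp, hpI⟩ := Finset.mem_sdiff.1 hp
    · exact Finset.mem_sdiff.2 ⟨hP p (Or.inl hp), hpI⟩
    · exact Finset.mem_sdiff.2 ⟨hP p (Or.inr (h.subQ p hp).1), hpI⟩
  have hcard := Finset.card_le_card hsub
  rw [Finset.card_union_of_disjoint hdisj, Finset.card_sdiff_of_subset hIP] at hcard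
  have hQ := Finset.card_sdiff_add_card_inter Q I
  have hw := h.cardQ
  have hIcard := Finset.card_le_card hIP
  rcases (Q ∩ I).eq_empty_or_nonempty with he | hne
  · rw [he, Finset.card_empty] at hQ
    omega
  · have := h.miss I hI hne
    omega

end Layout

section Strategy

/-- The points of `h` form a layout in the unit square, reached with `h.length` moves. -/
def IsGood (w : ℕ) (h : List Pt) : Prop :=
  ∃ r M U L Q xl xr yl yr,
    Layout (0 : ℝ) 1 w (w + waits w + reserve w - 1) h.length r M U L Q xl xr yl yr ∧
      ∀ p, (p ∈ M ∨ p ∈ U ∨ p ∈ L) ↔ p ∈ h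

theorem exists_mem_unitInterval_notMem (Y : Finset ℝ) : ∃ y ∈ Ioo (0 : ℝ) 1, y ∉ Y :=
  (Ioo_infinite one_pos).exists_notMem_finset Y

theorem exists_aValid : ∃ sA : AStrat, AValid sA := by
  choose f hf hf' using exists_mem_unitInterval_notMem
  exact ⟨fun h => f (h.map Prod.fst).toFinset, fun h => ⟨hf _, fun p hp e => hf' _
    (List.mem_toFinset.2 (List.mem_map.2 ⟨p, hp, e.symm⟩))⟩⟩

theorem IsGood.exists_append {w : ℕ} {h : List Pt} (hg : IsGood w h) {x : ℝ}
    (hx : x ∈ Ioo (0 : ℝ) 1) (hxh : ∀ p ∈ h, x ≠ p.1) :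
    ∃ y ∈ Ioo (0 : ℝ) 1, (∀ p ∈ h, y ≠ p.2) ∧ IsGood w (h ++ [(x, y)]) := by
  obtain ⟨r, M, U, L, Q, xl, xr, yl, yr, hlay, hmem⟩ := hg
  obtain ⟨y, hy0, hy1, hyY, r', M', U', L', Q', xl', xr', yl', yr', hlay', hmem'⟩ :=
    hlay.answerable (Y := (h.map Prod.snd).toFinset)
      (fun p hp => (hxh p ((hmem p).1 hp)).symm) hx.1 hx.2
  refine ⟨y, ⟨hy0, hy1⟩, fun p hp e => hyY (List.mem_toFinset.2 (e ▸ List.mem_map_of_mem hp)),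
    r', M', U', L', Q', xl', xr', yl', yr', by simpa using hlay', fun p => ?_⟩
  rw [hmem', hmem, List.mem_append, List.mem_singleton, or_comm]

theorem exists_bValid_isGood (w : ℕ) : ∃ sB : BStrat, BValid sB ∧
    ∀ (h : List Pt) (x : ℝ), IsGood w h → x ∈ Ioo (0 : ℝ) 1 → (∀ p ∈ h, x ≠ p.1) →
      IsGood w (h ++ [(x, sB h x)]) := by
  have key : ∀ (h : List Pt) (x : ℝ), ∃ y, (y ∈ Ioo (0 : ℝ) 1 ∧ ∀ p ∈ h, y ≠ p.2) ∧
      (IsGood w h → x ∈ Ioo (0 : ℝ) 1 → (∀ p ∈ h, x ≠ p.1) → IsGood w (h ++ [(x, y)])) := by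
    intro h x
    by_cases hc : IsGood w h ∧ x ∈ Ioo (0 : ℝ) 1 ∧ ∀ p ∈ h, x ≠ p.1
    · obtain ⟨y, hy, hyh, hg⟩ := hc.1.exists_append hc.2.1 hc.2.2
      exact ⟨y, ⟨hy, hyh⟩, fun _ _ _ => hg⟩
    · obtain ⟨y, hy, hyh⟩ := exists_mem_unitInterval_notMem (h.map Prod.snd).toFinset
      exact ⟨y, ⟨hy, fun p hp e => hyh (List.mem_toFinset.2 (e ▸ List.mem_map_of_mem hp))⟩,
        fun h1 h2 h3 => absurd ⟨h1, h2, h3⟩ hc⟩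
  choose sB hvalid hgood using key
  exact ⟨sB, hvalid, hgood⟩

variable {sA : AStrat} {sB : BStrat}

theorem length_hist (sA : AStrat) (sB : BStrat) (n : ℕ) : (hist sA sB n).length = n := by
  induction n with
  | zero => rfl
  | succ n ih => simp [hist, ih]

theorem isGood_hist {w : ℕ} (hA : AValid sA)
    (hB : ∀ (h : List Pt) (x : ℝ), IsGood w h → x ∈ Ioo (0 : ℝ) 1 → (∀ p ∈ h, x ≠ p.1) →
      IsGood w (h ++ [(x, sB h x)])) (n : ℕ) : IsGood w (hist sA sB n) := by
  induction n with
  | zero => exact ⟨w, ∅, ∅, ∅, ∅, 0, 1, 0, 1, layout_empty one_pos, by simp [hist]⟩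
  | succ n ih => exact hB _ _ ih (hA _).1 (hA _).2

theorem pairwise_fst_ne_hist (hA : AValid sA) (n : ℕ) :
    (hist sA sB n).Pairwise fun p q => p.1 ≠ q.1 := by
  induction n with
  | zero => exact List.Pairwise.nil
  | succ n ih =>
    refine List.pairwise_append.2 ⟨ih, List.pairwise_singleton _ _, fun p hp q hq => ?_⟩
    rw [List.mem_singleton.1 hq]
    exact ((hA _).2 p hp).symm

theorem played_mono (sA : AStrat) (sB : BStrat) : Monotone (played sA sB) :=
  monotone_nat_of_le_succ fun _ _ hp => List.mem_append_left _ hp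

theorem HasUpRun.mono {P P' : Set Pt} {n : ℕ} (h : HasUpRun P n) (hP : P ⊆ P') :
    HasUpRun P' n :=
  h.imp fun _ hf => ⟨fun i => hP (hf.1 i), hf.2⟩

theorem HasDownRun.mono {P P' : Set Pt} {n : ℕ} (h : HasDownRun P n) (hP : P ⊆ P') :
    HasDownRun P' n :=
  h.imp fun _ hf => ⟨fun i => hP (hf.1 i), hf.2⟩

theorem IsGood.not_hasUpRun {m w : ℕ} {h : List Pt} (hg : IsGood w h)
    (hT : w + waits w + reserve w - 1 ≤ h.length) (hm : h.length < m + w) :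
    ¬ HasUpRun {p | p ∈ h} m := by
  rintro ⟨f, hfh, hf1, hf2⟩
  obtain ⟨r, M, U, L, Q, xl, xr, yl, yr, hlay, hmem⟩ := hg
  obtain rfl : r = 0 := by
    by_contra hr
    have := hlay.time' (Nat.one_le_iff_ne_zero.2 hr)
    omega
  have hcard := hlay.card_add_le (P := h.toFinset) (I := Finset.univ.image f)
    (fun p hp => List.mem_toFinset.2 ((hmem p).1 hp))
    (Finset.image_subset_iff.2 fun i _ => List.mem_toFinset.2 (hfh i)) (by
      intro p hp q hq hlt
      obtain ⟨i, -, rfl⟩ := Finset.mem_image.1 hp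
      obtain ⟨j, -, rfl⟩ := Finset.mem_image.1 hq
      exact hf2 (hf1.lt_iff_lt.1 hlt).le)
  have hinj : Function.Injective f := fun i j e => hf1.injective (congrArg Prod.fst e)
  rw [Finset.card_image_of_injective _ hinj, Finset.card_univ, Fintype.card_fin] at hcard
  have := h.toFinset_card_le
  omega

theorem IsGood.not_hasDownRun {w : ℕ} {h : List Pt} (hg : IsGood w h) :
    ¬ HasDownRun {p | p ∈ h} 3 := by
  rintro ⟨f, hfh, hf1, hf2⟩
  obtain ⟨r, M, U, L, Q, xl, xr, yl, yr, hlay, hmem⟩ := hg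
  have key : ∀ i j, i < j → ¬ (f i ∈ M ∧ f j ∈ M) ∧
      ¬ ((f i ∈ U ∨ f i ∈ L) ∧ (f j ∈ U ∨ f j ∈ L)) := by
    intro i j hij
    have h1 := hf1 hij
    have h2 := hf2 hij
    refine ⟨fun hM => (hlay.riseM _ hM.1 _ hM.2 h1).not_gt h2, ?_⟩
    rintro ⟨hi | hi, hj | hj⟩
    · exact (hlay.riseU _ hi _ hj h1).not_gt h2
    · exact (((hlay.leU _ hi).2.trans_lt hlay.lty).trans_le (hlay.geL _ hj).2).not_gt h2
    · exact (((hlay.leU _ hj).1.trans_lt hlay.ltx).trans_le (hlay.geL _ hi).1).not_gt h1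
    · exact (hlay.riseL _ hi _ hj h1).not_gt h2
  have h01 := key 0 1 (by decide)
  have h02 := key 0 2 (by decide)
  have h12 := key 1 2 (by decide)
  rcases (hmem _).2 (hfh 0) with h0 | h0 <;> rcases (hmem _).2 (hfh 1) with h1 | h1
  · exact h01.1 ⟨h0, h1⟩
  · rcases (hmem _).2 (hfh 2) with h2 | h2
    · exact h02.1 ⟨h0, h2⟩
    · exact h12.2 ⟨h1, h2⟩
  · rcases (hmem _).2 (hfh 2) with h2 | h2
    · exact h12.1 ⟨h1, h2⟩
    · exact h02.2 ⟨h0, h2⟩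
  · exact h01.2 ⟨h0, h1⟩

end Strategy

section ErdosSzekeres

/-- A finite form of the Erdős–Szekeres theorem: peel off the points without a point to the
lower left. -/
theorem card_le_mul_of_no_chain {α : Type*} [LinearOrder α] (m k : ℕ) (P : Finset (α × α))
    (hP : ∀ p ∈ P, ∀ q ∈ P, p.1 = q.1 → p = q)
    (hup : ∀ I ⊆ P, (∀ p ∈ I, ∀ q ∈ I, p.1 < q.1 → p.2 ≤ q.2) → I.card ≠ m + 1)
    (hdown : ∀ I ⊆ P, (∀ p ∈ I, ∀ q ∈ I, p.1 < q.1 → q.2 < p.2) → I.card ≠ k + 1) :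
    P.card ≤ m * k := by
  induction m generalizing P with
  | zero =>
    rcases P.eq_empty_or_nonempty with rfl | ⟨p, hp⟩
    · simp
    · refine absurd (Finset.card_singleton p) (hup _ (Finset.singleton_subset_iff.2 hp) ?_)
      intro a ha b hb hlt
      rw [Finset.mem_singleton.1 ha, Finset.mem_singleton.1 hb] at hlt
      exact absurd hlt (lt_irrefl _)
  | succ m ih =>
    set D := P.filter fun p => ∀ q ∈ P, q.1 < p.1 → p.2 < q.2 with hD
    have hDP : D ⊆ P := Finset.filter_subset _ _
    have hDk : D.card ≤ k := by
      by_contra hlt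
      obtain ⟨I, hID, hI⟩ := Finset.exists_subset_card_eq (not_le.1 hlt)
      exact hdown I (hID.trans hDP) (fun p hp q hq hpq =>
        (Finset.mem_filter.1 (hID hq)).2 p (hDP (hID hp)) hpq) hI
    have hrest : (P \ D).card ≤ m * k := by
      refine ih _ (fun p hp q hq => hP p (Finset.sdiff_subset hp) q (Finset.sdiff_subset hq))
        (fun I hI hrise hcard => ?_) fun I hI => hdown I (hI.trans Finset.sdiff_subset)
      obtain ⟨a, ha, hmin⟩ := I.exists_min_image Prod.fst (Finset.card_pos.1 (by omega))
      obtain ⟨haP, haD⟩ := Finset.mem_sdiff.1 (hI ha)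
      simp only [hD, Finset.mem_filter, haP, true_and] at haD
      push Not at haD
      obtain ⟨q, hqP, hqa, hqa'⟩ := haD
      refine hup (insert q I) (Finset.insert_subset hqP (hI.trans Finset.sdiff_subset)) ?_ ?_
      · intro b hb c hc hlt
        rcases Finset.mem_insert.1 hb with rfl | hbI <;>
          rcases Finset.mem_insert.1 hc with rfl | hcI
        · exact le_rfl
        · rcases (hmin c hcI).eq_or_lt with e | hac
          · rwa [← hP a haP c (Finset.sdiff_subset (hI hcI)) e]
          · exact hqa'.trans (hrise a ha c hcI hac)
        · exact absurd (hlt.trans hqa) (hmin b hbI).not_gt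
        · exact hrise b hbI c hcI hlt
      · rw [Finset.card_insert_of_notMem fun hq => (hmin q hq).not_gt hqa, hcard]
    have := Finset.card_sdiff_add_card_eq_card hDP
    rw [Nat.succ_mul]
    omega

theorem exists_enum_strictMono_fst {I : Finset Pt} {n : ℕ} (hn : I.card = n)
    (hI : ∀ p ∈ I, ∀ q ∈ I, p.1 = q.1 → p = q) :
    ∃ f : Fin n → Pt, (∀ i, f i ∈ I) ∧ StrictMono fun i => (f i).1 := by
  have hcard : (I.image Prod.fst).card = n := by
    rw [Finset.card_image_of_injOn fun p hp q hq => hI p hp q hq, hn]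
  have key : ∀ i, ∃ p ∈ I, p.1 = (I.image Prod.fst).orderEmbOfFin hcard i := fun i =>
    Finset.mem_image.1 (Finset.orderEmbOfFin_mem _ hcard i)
  choose f hf hf' using key
  exact ⟨f, hf, by simpa only [hf'] using ((I.image Prod.fst).orderEmbOfFin hcard).strictMono⟩

theorem hasUpRun_or_hasDownRun_of_lt_card {m k : ℕ} {P : Finset Pt}
    (hP : ∀ p ∈ P, ∀ q ∈ P, p.1 = q.1 → p = q) (hcard : m * k < P.card) :
    HasUpRun (P : Set Pt) (m + 1) ∨ HasDownRun (P : Set Pt) (k + 1) := by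
  by_contra hno
  rw [not_or] at hno
  refine hcard.not_ge (card_le_mul_of_no_chain m k P hP (fun I hI hrise hc => hno.1 ?_)
    fun I hI hfall hc => hno.2 ?_)
  all_goals
    obtain ⟨f, hf, hmono⟩ := exists_enum_strictMono_fst hc
      fun p hp q hq => hP p (hI hp) q (hI hq)
    refine ⟨f, fun i => hI (hf i), hmono, fun i j hij => ?_⟩
  · rcases hij.eq_or_lt with rfl | hlt
    · exact le_rfl
    · exact hrise _ (hf i) _ (hf j) (hmono hlt)
  · exact hfall _ (hf i) _ (hf j) (hmono hij)

theorem exists_aWinsBy (m k : ℕ) : ∃ sA : AStrat, AWinsBy (m + 1) (k + 1) (m * k + 1) sA := by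
  obtain ⟨sA, hA⟩ := exists_aValid
  refine ⟨sA, hA, fun sB _ => ?_⟩
  have hpair := pairwise_fst_ne_hist (sB := sB) hA (m * k + 1)
  have hcoe : played sA sB (m * k + 1) = ((hist sA sB (m * k + 1)).toFinset : Set Pt) := by
    ext p
    simp [played]
  rw [hcoe]
  refine hasUpRun_or_hasDownRun_of_lt_card (fun p hp q hq e => ?_) ?_
  · have : Std.Symm fun p q : Pt => p.1 ≠ q.1 := ⟨fun _ _ => Ne.symm⟩
    by_contra hne
    exact hpair.forall (List.mem_toFinset.1 hp) (List.mem_toFinset.1 hq) hne e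
  · rw [List.toFinset_card_of_nodup (hpair.imp fun h e => h (congrArg Prod.fst e)), length_hist]
    exact Nat.lt_succ_self _

end ErdosSzekeres

theorem ESO_m3_ge_of_cube (m w : ℕ) (hm : 1 ≤ m) (hw : 1 ≤ w)
    (hcube : (w + 1) ^ 3 - (w + 1) < 6 * m) :
    m + w ≤ ESO m 3 ∧
    ∃ sB : BStrat, BValid sB ∧ ∀ sA : AStrat, AValid sA →
      ¬ HasUpRun (played sA sB (m + w - 1)) m ∧
      ¬ HasDownRun (played sA sB (m + w - 1)) 3 := by
  obtain ⟨sB, hvalid, hgood⟩ := exists_bValid_isGood w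
  have hT : w + waits w + reserve w - 1 ≤ m + w - 1 := by
    have hsix := six_mul_waits_add_reserve w
    have hexp : (w + 1) ^ 3 = w * (w + 1) * (w + 2) + (w + 1) := by ring
    rw [hexp, Nat.add_sub_cancel] at hcube
    omega
  have hmain : ∀ sA : AStrat, AValid sA → ¬ HasUpRun (played sA sB (m + w - 1)) m ∧
      ¬ HasDownRun (played sA sB (m + w - 1)) 3 := by
    intro sA hA
    have hg := isGood_hist hA hgood (m + w - 1)
    have hlen := length_hist sA sB (m + w - 1)
    exact ⟨hg.not_hasUpRun (by omega) (by omega), hg.not_hasDownRun⟩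
  refine ⟨?_, sB, hvalid, hmain⟩
  obtain ⟨m, rfl⟩ := Nat.exists_eq_add_of_le' hm
  refine le_csInf ⟨_, exists_aWinsBy m 2⟩ ?_
  rintro N ⟨sA, hA, hwin⟩
  by_contra hlt
  have hsub := played_mono sA sB (show N ≤ m + 1 + w - 1 by omega)
  exact (hwin sB hvalid).elim (fun h => (hmain sA hA).1 (h.mono hsub))
    fun h => (hmain sA hA).2 (h.mono hsub)
end
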